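/- arXiv:2109.05970 — 3 statements merged into one kernel-verified Lean document; each statement's English description precedes it below -/
import Mathlib

section
/- Let J be a nonempty, at most countable set and k ≥ 0. For each j ∈ J let S_j be a bounded weighted shift on a rooted directed tree T_j=(V_j,p_j) with root ω_j, the trees being pairwise disjoint. Then the following are equivalent: (a) there exists a system (θ_j)_{j∈J} of nonzero complex numbers such that the weighted shift S_λ on the rooted sum of the T_j's, with weights λ satisfying λ_{ω_j} = θ_j and S_{λ→_{ω_j}} = S_j for all j (and weight 0 at the new root), admits a subnormal k-step backward extension; (b) each S_j admits a subnormal (k+1)-step backward extension and sup{‖S_j‖ : j ∈ J} < ∞. Moreover, if (a) holds then ‖S_λ‖ = sup{‖S_j‖ : j ∈ J}. -/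
open scoped ENNReal Classical
noncomputable section

universe u

namespace ShiftsPaper

/-- ℓ²(V) over ℂ. -/
abbrev Hs (V : Type u) : Type u := lp (fun _ : V => ℂ) 2

/-- canonical orthonormal basis vector -/
def ev {V : Type u} (v : V) : Hs V := lp.single 2 v 1

/-- A directed forest: a nonempty vertex set together with a parent function `p`
such that any vertex lying on a `p`-cycle is a fixed point of `p`. -/
def IsDirectedForest {V : Type u} (p : V → V) : Prop :=
  Nonempty V ∧ ∀ n : ℕ, 1 ≤ n → ∀ v : V, p^[n] v = v → p v = v

def rootSet {V : Type u} (p : V → V) : Set V := {v | p v = v}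

def children {V : Type u} (p : V → V) (v : V) : Set V := {u | p u = v ∧ u ≠ v}

/-- the set of `k`-th children `Chi^⟨k⟩(v)` -/
def childrenIter {V : Type u} (p : V → V) : ℕ → V → Set V
  | 0, v => {v}
  | k + 1, v => {u | p^[k + 1] u = v ∧ p^[k] u ≠ v}

/-- descendants -/
def des {V : Type u} (p : V → V) (v : V) : Set V := ⋃ n : ℕ, childrenIter p n v

lemma self_mem_des {V : Type u} (p : V → V) (v : V) : v ∈ des p v :=
  Set.mem_iUnion.2 ⟨0, by simp [childrenIter]⟩

/-- `u` and `v` belong to the same tree (connected component) of the forest -/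
def sameTree {V : Type u} (p : V → V) (u v : V) : Prop :=
  ∃ m n : ℕ, p^[m] u = p^[n] v

/-- A directed tree is a connected directed forest. -/
def IsDirectedTree {V : Type u} (p : V → V) : Prop :=
  IsDirectedForest p ∧ ∀ u v : V, sameTree p u v

def Leafless {V : Type u} (p : V → V) : Prop := Function.Surjective p

def LocallyCountable {V : Type u} (p : V → V) : Prop :=
  ∀ v : V, (children p v).Countable

/-- every non-root vertex has exactly one child -/
def Forkless {V : Type u} (p : V → V) : Prop :=
  ∀ v : V, p v ≠ v → ∃! u : V, u ∈ children p v

/-- a system of weights: vanishing at the roots -/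
def WeightSystem {V : Type u} (p : V → V) (lam : V → ℂ) : Prop :=
  ∀ v : V, p v = v → lam v = 0

/-- a proper system of weights: vanishing exactly at the roots -/
def ProperWeights {V : Type u} (p : V → V) (lam : V → ℂ) : Prop :=
  ∀ v : V, lam v = 0 ↔ p v = v

/-- `S` is the (bounded) weighted shift on the forest `(V, p)` with weights `lam`:
`(S f)(v) = lam v • f (p v)`. -/
def IsWeightedShift {V : Type u} (p : V → V) (lam : V → ℂ)
    (S : Hs V →L[ℂ] Hs V) : Prop :=
  ∀ (f : Hs V) (v : V), (S f : ∀ _ : V, ℂ) v = lam v * (f : ∀ _ : V, ℂ) (p v)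

def Hyponormal {E : Type u} [NormedAddCommGroup E] [InnerProductSpace ℂ E]
    [CompleteSpace E] (A : E →L[ℂ] E) : Prop :=
  (ContinuousLinearMap.adjoint A ∘L A - A ∘L ContinuousLinearMap.adjoint A).IsPositive

def PowerHyponormal {E : Type u} [NormedAddCommGroup E] [InnerProductSpace ℂ E]
    [CompleteSpace E] (A : E →L[ℂ] E) : Prop :=
  ∀ n : ℕ, 1 ≤ n → Hyponormal (A ^ n)

/-- `A` is subnormal: it is the restriction of a bounded normal operator on a larger
Hilbert space to an invariant subspace. -/
def Subnormal {E : Type u} [NormedAddCommGroup E] [InnerProductSpace ℂ E]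
    [CompleteSpace E] (A : E →L[ℂ] E) : Prop :=
  ∃ (K : Type u) (_ : NormedAddCommGroup K) (_ : InnerProductSpace ℂ K)
    (_ : CompleteSpace K) (J : E →ₗᵢ[ℂ] K) (N : K →L[ℂ] K),
    IsStarNormal N ∧ ∀ x : E, N (J x) = J (A x)

/-- `μ` is a representing measure (a positive Borel measure on `[0,∞)`) for the
sequence `a`. -/
def IsRepresentingMeasure (μ : MeasureTheory.Measure ℝ) (a : ℕ → ℝ) : Prop :=
  μ (Set.Iio 0) = 0 ∧
    ∀ n : ℕ, ENNReal.ofReal (a n) = ∫⁻ x : ℝ, ENNReal.ofReal (x ^ n) ∂μ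

def IsStieltjesMomentSeq (a : ℕ → ℝ) : Prop :=
  (∀ n, 0 ≤ a n) ∧ ∃ μ : MeasureTheory.Measure ℝ, IsRepresentingMeasure μ a

/-- parent function of the `k`-step backward extension `T⟨k⟩`; the new vertices
`ω_1, …, ω_k` are encoded as `Sum.inr ⟨0⟩, …, Sum.inr ⟨k-1⟩`. -/
def extParent {V : Type u} (p : V → V) (ω : V) (k : ℕ) :
    V ⊕ Fin k → V ⊕ Fin k
  | Sum.inl v =>
      if v = ω then (if h : 0 < k then Sum.inr ⟨0, h⟩ else Sum.inl ω)
      else Sum.inl (p v)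
  | Sum.inr j =>
      if h : (j : ℕ) + 1 < k then Sum.inr ⟨(j : ℕ) + 1, h⟩ else Sum.inr j

/-- weights on `T⟨k⟩`: weight `mu 0 = λ'_{ω_0}` at the old root `ω`, weight
`mu (j+1) = λ'_{ω_{j+1}}` at `ω_{j+1}` for `j+1 < k`, weight `0` at the new root `ω_k`. -/
def extWeights {V : Type u} (lam : V → ℂ) (ω : V) (k : ℕ) (mu : Fin k → ℂ) :
    V ⊕ Fin k → ℂ
  | Sum.inl v => if v = ω then (if h : 0 < k then mu ⟨0, h⟩ else 0) else lam v
  | Sum.inr j => if h : (j : ℕ) + 1 < k then mu ⟨(j : ℕ) + 1, h⟩ else 0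

/-- `S` (the weighted shift with weights `lam` on a tree rooted at `ω`) admits a
subnormal `k`-step backward extension. -/
def AdmitsSubnormalBackExt {V : Type u} (p : V → V) (lam : V → ℂ) (ω : V)
    (S : Hs V →L[ℂ] Hs V) (k : ℕ) : Prop :=
  Subnormal S ∧
    ∃ mu : Fin k → ℂ, (∀ j, mu j ≠ 0) ∧
      ∃ S' : Hs (V ⊕ Fin k) →L[ℂ] Hs (V ⊕ Fin k),
        IsWeightedShift (extParent p ω k) (extWeights lam ω k mu) S' ∧ Subnormal S'

def AdmitsPowerHypoBackExt {V : Type u} (p : V → V) (lam : V → ℂ) (ω : V)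
    (S : Hs V →L[ℂ] Hs V) (k : ℕ) : Prop :=
  PowerHyponormal S ∧
    ∃ mu : Fin k → ℂ, (∀ j, mu j ≠ 0) ∧
      ∃ S' : Hs (V ⊕ Fin k) →L[ℂ] Hs (V ⊕ Fin k),
        IsWeightedShift (extParent p ω k) (extWeights lam ω k mu) S' ∧
        PowerHyponormal S'

/-- the parent function of the subforest `T|_W`. -/
def restrictParent {V : Type u} (p : V → V) (W : Set V) : W → W :=
  fun v => if h : p ↑v ∈ W then ⟨p ↑v, h⟩ else v

/-- the weights `λ→_u` on the subtree `T_(u→)` of descendants of `u`. -/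
def subWeights {V : Type u} (lam : V → ℂ) (u : V) (W : Set V) : W → ℂ :=
  fun v => if (v : V) = u then 0 else lam ↑v

/-- parent function of the rooted sum of the family `{(V j, p j)}` with roots `ω j`;
the new root is `none`. -/
def rsParent {J : Type u} {V : J → Type u} (p : ∀ j, V j → V j) (ω : ∀ j, V j) :
    Option (Σ j, V j) → Option (Σ j, V j)
  | none => none
  | some ⟨j, v⟩ => if v = ω j then none else some ⟨j, p j v⟩

/-- weights on the rooted sum: `0` at the new root, `θ j` at the old root `ω j`. -/
def rsWeights {J : Type u} {V : J → Type u} (lam : ∀ j, V j → ℂ) (ω : ∀ j, V j)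
    (θ : J → ℂ) : Option (Σ j, V j) → ℂ
  | none => 0
  | some ⟨j, v⟩ => if v = ω j then θ j else lam j v

/-- iterated weights `λ^(k)_v`. -/
def iterWeight {V : Type u} (p : V → V) (lam : V → ℂ) : ℕ → V → ℂ
  | 0, _ => 1
  | k + 1, v => iterWeight p lam k (p v) * lam v

/-- parent function `p^[k]` of the `k`-th power forest `T^k`. -/
def kPowParent {V : Type u} (p : V → V) (k : ℕ) (v : V) : V :=
  if p (p^[k - 1] v) = p^[k - 1] v then v else p^[k] v



/-! ### Normal operators -/

section normal
variable {K : Type*} [NormedAddCommGroup K] [InnerProductSpace ℂ K] [CompleteSpace K]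

open ContinuousLinearMap in
lemma normal_norm_sq_le (N : K →L[ℂ] K) (hN : IsStarNormal N) (x : K) :
    ‖N x‖ ^ 2 ≤ ‖N (N x)‖ * ‖x‖ := by
  have h1 : ‖N (N x)‖ = ‖adjoint N (N x)‖ :=
    (isStarNormal_iff_norm_eq_adjoint.1 hN) (N x)
  have h2 : inner ℂ (adjoint N (N x)) x = (‖N x‖ : ℂ) ^ 2 := by
    rw [adjoint_inner_left, inner_self_eq_norm_sq_to_K]; simp
  have h3 := norm_inner_le_norm (𝕜 := ℂ) (adjoint N (N x)) x
  rw [h2, ← h1] at h3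
  simpa using h3

lemma isStarNormal_of_adj (N M : K →L[ℂ] K) (h : ∀ x y, inner ℂ (N x) y = inner ℂ x (M y))
    (hc : ∀ x, N (M x) = M (N x)) : IsStarNormal N := by
  have : M = ContinuousLinearMap.adjoint N := by
    rw [ContinuousLinearMap.eq_adjoint_iff]
    intro x y
    rw [← inner_conj_symm, ← h, inner_conj_symm]
  refine ⟨?_⟩
  rw [ContinuousLinearMap.star_eq_adjoint, ← this]
  ext x
  exact (hc x).symm

lemma normal_comm (N : K →L[ℂ] K) (hN : IsStarNormal N) (x : K) :
    N (ContinuousLinearMap.adjoint N x) = ContinuousLinearMap.adjoint N (N x) := by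
  have := hN.star_comm_self
  rw [ContinuousLinearMap.star_eq_adjoint] at this
  exact (congrArg (fun A : K →L[ℂ] K => A x) this.eq).symm

/-- vectors on which powers of a normal operator grow at rate at most `r` -/
def growthSub (N : K →L[ℂ] K) (r : ℝ) : Submodule ℂ K where
  carrier := {x | ∃ D : ℝ, ∀ n : ℕ, ‖(N ^ n) x‖ ≤ D * r ^ n}
  add_mem' := by
    rintro x y ⟨D, hD⟩ ⟨D', hD'⟩
    refine ⟨D + D', fun n => ?_⟩
    rw [map_add, add_mul]
    exact (norm_add_le _ _).trans (add_le_add (hD n) (hD' n))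
  zero_mem' := ⟨0, fun n => by simp⟩
  smul_mem' := by
    rintro c x ⟨D, hD⟩
    refine ⟨‖c‖ * D, fun n => ?_⟩
    rw [map_smul, norm_smul, mul_assoc]
    exact mul_le_mul_of_nonneg_left (hD n) (norm_nonneg _)

lemma growth_pow (N : K →L[ℂ] K) (hN : IsStarNormal N) (x : K) (hx : N x ≠ 0) (n : ℕ) :
    ‖N x‖ * (‖N x‖ / ‖x‖) ^ n ≤ ‖(N ^ (n + 1)) x‖ ∧
      ‖(N ^ n) x‖ * (‖N x‖ / ‖x‖) ≤ ‖(N ^ (n + 1)) x‖ ∧ (N ^ n) x ≠ 0 := by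
  have hx0 : x ≠ 0 := by rintro rfl; simp at hx
  have hxp : 0 < ‖x‖ := norm_pos_iff.2 hx0
  have hNp : 0 < ‖N x‖ := norm_pos_iff.2 hx
  induction n with
  | zero => refine ⟨by simp, ?_, by simpa⟩; simp; field_simp; rfl
  | succ n ih =>
    obtain ⟨h1, h2, h3⟩ := ih
    set y := (N ^ n) x with hy
    have e1 : (N ^ (n + 1)) x = N y := by rw [pow_succ']; rfl
    have e2 : (N ^ (n + 1 + 1)) x = N (N y) := by rw [pow_succ', pow_succ']; rfl
    rw [e1] at h1 h2
    have hyp : 0 < ‖y‖ := norm_pos_iff.2 h3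
    have hNy : 0 < ‖N y‖ := lt_of_lt_of_le (by positivity) h2
    have h4 := normal_norm_sq_le N hN y
    have h5 : ‖N y‖ * (‖N x‖ / ‖x‖) ≤ ‖N (N y)‖ := by
      have : ‖N y‖ * (‖y‖ * (‖N x‖ / ‖x‖)) ≤ ‖N (N y)‖ * ‖y‖ :=
        le_trans (by rw [pow_two]; exact mul_le_mul_of_nonneg_left h2 hNy.le) h4
      have h6 : (‖N y‖ * (‖N x‖ / ‖x‖)) * ‖y‖ ≤ ‖N (N y)‖ * ‖y‖ := by linarith
      exact le_of_mul_le_mul_right h6 hyp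
    rw [e1, e2]
    refine ⟨?_, h5, norm_pos_iff.1 hNy⟩
    rw [pow_succ, ← mul_assoc]
    exact le_trans (mul_le_mul_of_nonneg_right h1 (by positivity)) h5

lemma growth_le (N : K →L[ℂ] K) (hN : IsStarNormal N) {r : ℝ} (hr : 0 ≤ r) {x : K}
    (hx : x ∈ growthSub N r) : ‖N x‖ ≤ r * ‖x‖ := by
  obtain ⟨D, hD⟩ := hx
  by_cases h0 : N x = 0
  · rw [h0, norm_zero]; positivity
  have hx0 : x ≠ 0 := by rintro rfl; simp at h0
  have hxp : 0 < ‖x‖ := norm_pos_iff.2 hx0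
  have hNp : 0 < ‖N x‖ := norm_pos_iff.2 h0
  by_contra hcon
  push Not at hcon
  set q := ‖N x‖ / ‖x‖ with hq
  have hrq : r < q := by rw [hq, lt_div_iff₀ hxp]; exact hcon
  have hqp : 0 < q := lt_of_le_of_lt hr hrq
  have key : ∀ n : ℕ, ‖N x‖ ≤ (D * r) * (r / q) ^ n := by
    intro n
    have h := (growth_pow N hN x h0 n).1.trans (hD (n + 1))
    rw [div_pow, ← mul_div_assoc, le_div_iff₀ (by positivity)]
    calc _ ≤ _ := h
      _ = _ := by ring
  have lim : Filter.Tendsto (fun n : ℕ => (D * r) * (r / q) ^ n) Filter.atTop (nhds ((D * r) * 0)) :=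
    (tendsto_pow_atTop_nhds_zero_of_lt_one (by positivity) ((div_lt_one hqp).2 hrq)).const_mul _
  have := ge_of_tendsto' lim key
  rw [mul_zero] at this
  linarith

lemma growth_map (N : K →L[ℂ] K) {r : ℝ} {x : K}
    (hx : x ∈ growthSub N r) : N x ∈ growthSub N r := by
  obtain ⟨D, hD⟩ := hx
  refine ⟨D * r, fun n => ?_⟩
  have := hD (n + 1)
  rw [pow_succ (M := K →L[ℂ] K)] at this
  calc _ ≤ _ := this
    _ = _ := by ring

lemma growth_map_adj (N : K →L[ℂ] K) (hN : IsStarNormal N) {r : ℝ} {x : K}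
    (hx : x ∈ growthSub N r) : ContinuousLinearMap.adjoint N x ∈ growthSub N r := by
  obtain ⟨D, hD⟩ := hx
  refine ⟨‖ContinuousLinearMap.adjoint N‖ * D, fun n => ?_⟩
  have hcm : (N ^ n) (ContinuousLinearMap.adjoint N x)
      = ContinuousLinearMap.adjoint N ((N ^ n) x) := by
    have := hN.star_comm_self
    rw [ContinuousLinearMap.star_eq_adjoint] at this
    have h2 := (this.pow_right n).eq
    exact (congrArg (fun A : K →L[ℂ] K => A x) h2).symm
  rw [hcm, mul_assoc]
  exact (ContinuousLinearMap.le_opNorm _ _).trans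
    (mul_le_mul_of_nonneg_left (hD n) (norm_nonneg _))

lemma growth_closed (N : K →L[ℂ] K) (hN : IsStarNormal N) {r : ℝ} (hr : 0 ≤ r) :
    IsClosed (growthSub N r : Set K) := by
  have : (growthSub N r : Set K) = ⋂ n : ℕ, {x | ‖(N ^ n) x‖ ≤ ‖x‖ * r ^ n} := by
    ext x
    simp only [Set.mem_iInter, Set.mem_ofPred_eq, SetLike.mem_coe]
    constructor
    · intro hx n
      have hmem : ∀ n : ℕ, (N ^ n) x ∈ growthSub N r := by
        intro n
        induction n with
        | zero => simpa
        | succ n ih => rw [pow_succ']; exact growth_map N ih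
      induction n with
      | zero => simp
      | succ n ih =>
        rw [pow_succ' (M := K →L[ℂ] K)]
        calc _ ≤ r * ‖(N ^ n) x‖ := growth_le N hN hr (hmem n)
          _ ≤ r * (‖x‖ * r ^ n) := mul_le_mul_of_nonneg_left ih hr
          _ = _ := by ring
    · intro h
      exact ⟨‖x‖, h⟩
  rw [this]
  refine isClosed_iInter fun n => isClosed_le ?_ ?_ <;> fun_prop

end normal

lemma subnormal_bounded {E : Type u} [NormedAddCommGroup E] [InnerProductSpace ℂ E]
    [CompleteSpace E] (A : E →L[ℂ] E) (hA : Subnormal A) {r : ℝ} (hr : ‖A‖ ≤ r) :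
    ∃ (K : Type u) (_ : NormedAddCommGroup K) (_ : InnerProductSpace ℂ K)
      (_ : CompleteSpace K) (J : E →ₗᵢ[ℂ] K) (N : K →L[ℂ] K),
      IsStarNormal N ∧ (∀ x : E, N (J x) = J (A x)) ∧ ‖N‖ ≤ r := by
  obtain ⟨K, i1, i2, i3, J, N, hN, hJ⟩ := hA
  have hr0 : 0 ≤ r := (norm_nonneg _).trans hr
  have hcl := growth_closed N hN hr0
  have hpow : ∀ (n : ℕ) x, (N ^ n) (J x) = J ((A ^ n) x) := by
    intro n
    induction n with
    | zero => intro x; simp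
    | succ n ih => intro x; rw [pow_succ, pow_succ]; simp [hJ, ih]
  have hmem : ∀ x, J x ∈ growthSub N r := fun x => by
    refine ⟨‖x‖, fun n => ?_⟩
    rw [hpow, J.norm_map]
    calc ‖(A ^ n) x‖ ≤ ‖A ^ n‖ * ‖x‖ := ContinuousLinearMap.le_opNorm _ _
      _ ≤ r ^ n * ‖x‖ := by
        refine mul_le_mul_of_nonneg_right ?_ (norm_nonneg _)
        rcases Nat.eq_zero_or_pos n with rfl | hn
        · rw [pow_zero, pow_zero]; exact ContinuousLinearMap.norm_id_le
        · exact (norm_pow_le' A hn).trans (pow_le_pow_left₀ (norm_nonneg _) hr n)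
      _ = _ := mul_comm _ _
  have : CompleteSpace (growthSub N r) := hcl.completeSpace_coe
  let N' : growthSub N r →L[ℂ] growthSub N r :=
    (N.comp (growthSub N r).subtypeL).codRestrict _ (fun x => growth_map N x.2)
  let M' : growthSub N r →L[ℂ] growthSub N r :=
    ((ContinuousLinearMap.adjoint N).comp (growthSub N r).subtypeL).codRestrict _
      (fun x => growth_map_adj N hN x.2)
  let J' : E →ₗᵢ[ℂ] growthSub N r :=
    { toLinearMap := J.toLinearMap.codRestrict _ hmem
      norm_map' := fun x => J.norm_map x }
  refine ⟨growthSub N r, inferInstance, inferInstance, inferInstance, J', N', ?_, ?_, ?_⟩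
  · refine isStarNormal_of_adj N' M' ?_ ?_
    · intro x y
      exact (ContinuousLinearMap.adjoint_inner_right N (x : K) (y : K)).symm
    · intro x
      exact Subtype.ext (normal_comm N hN x)
  · intro x
    exact Subtype.ext (hJ x)
  · exact ContinuousLinearMap.opNorm_le_bound _ hr0 (fun x => growth_le N hN hr0 x.2)

lemma subnormal_norm_sq_le {E : Type u} [NormedAddCommGroup E] [InnerProductSpace ℂ E]
    [CompleteSpace E] (A : E →L[ℂ] E) (hA : Subnormal A) (x : E) :
    ‖A x‖ ^ 2 ≤ ‖A (A x)‖ * ‖x‖ := by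
  obtain ⟨K, i1, i2, i3, J, N, hN, hJ⟩ := hA
  have := normal_norm_sq_le N hN (J x)
  simpa only [hJ, J.norm_map] using this

lemma subnormal_norm_le_of_pow {E : Type u} [NormedAddCommGroup E] [InnerProductSpace ℂ E]
    [CompleteSpace E] (A : E →L[ℂ] E) (hA : Subnormal A) {r : ℝ} (hr : 0 ≤ r)
    (s : Set E) (hs : ∀ g ∈ s, ‖A g‖ ≤ r * ‖g‖) (m : ℕ) :
    ∀ h : E, (A ^ m) h ∈ s → ‖A h‖ ≤ r * ‖h‖ := by
  induction m with
  | zero => intro h hh; exact hs h (by simpa using hh)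
  | succ m ih =>
    intro h hh
    have h1 := ih (A h) (by rw [pow_succ] at hh; exact hh)
    have h2 := subnormal_norm_sq_le A hA h
    by_cases h0 : A h = 0
    · rw [h0, norm_zero]; positivity
    · have hp : 0 < ‖A h‖ := norm_pos_iff.2 h0
      have h4 : ‖A h‖ * ‖A h‖ ≤ (r * ‖h‖) * ‖A h‖ := by
        calc _ = ‖A h‖ ^ 2 := by ring
          _ ≤ _ := h2
          _ ≤ (r * ‖A h‖) * ‖h‖ := mul_le_mul_of_nonneg_right h1 (norm_nonneg _)
          _ = _ := by ring
      exact le_of_mul_le_mul_right h4 hp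

/-! ### A range lemma for normal operators -/

section range
variable {K : Type u} [NormedAddCommGroup K] [InnerProductSpace ℂ K] [CompleteSpace K]

lemma re_inner_self (x : K) : (inner ℂ x x).re = ‖x‖ ^ 2 := inner_self_eq_norm_sq (𝕜 := ℂ) x

lemma symm_pow (B : K →L[ℂ] K) (hB : ∀ x y, inner ℂ (B x) y = inner ℂ x (B y)) (n : ℕ) :
    ∀ x y, inner ℂ ((B ^ n) x) y = inner ℂ x ((B ^ n) y) := by
  induction n with
  | zero => intro x y; simp
  | succ n ih =>
    intro x y
    rw [pow_succ]
    change inner ℂ ((B ^ n) (B x)) y = inner ℂ x ((B ^ n) (B y))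
    rw [ih, hB, ← mul_apply_eq_comp, ← mul_apply_eq_comp,
      ← pow_succ', pow_succ]

lemma pow_add_app (B : K →L[ℂ] K) (m n : ℕ) (x : K) : (B ^ (m + n)) x = (B ^ m) ((B ^ n) x) := by
  rw [pow_add]; rfl

lemma contr_pow_nonneg (B : K →L[ℂ] K) (hB : ∀ x y, inner ℂ (B x) y = inner ℂ x (B y))
    (h0 : ∀ x, 0 ≤ (inner ℂ (B x) x).re) (n : ℕ) (x : K) : 0 ≤ (inner ℂ ((B ^ n) x) x).re := by
  obtain ⟨l, rfl | rfl⟩ := Nat.even_or_odd' n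
  · rw [two_mul, pow_add_app, symm_pow B hB]
    exact inner_self_nonneg (𝕜 := ℂ)
  · rw [two_mul, add_assoc, pow_add_app, symm_pow B hB, add_comm l 1, pow_add_app, pow_one]
    exact h0 _

lemma contr_pow_anti (B : K →L[ℂ] K) (hB : ∀ x y, inner ℂ (B x) y = inner ℂ x (B y))
    (h0 : ∀ x, 0 ≤ (inner ℂ (B x) x).re) (h1 : ∀ x, (inner ℂ (B x) x).re ≤ (inner ℂ x x).re)
    (x : K) : Antitone (fun n : ℕ => (inner ℂ ((B ^ n) x) x).re) := by
  refine antitone_nat_of_succ_le fun n => ?_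
  obtain ⟨l, rfl | rfl⟩ := Nat.even_or_odd' n
  · rw [show 2 * l + 1 = l + (1 + l) by ring, pow_add_app, symm_pow B hB, pow_add_app B 1, pow_one,
      show 2 * l = l + l by ring, pow_add_app, symm_pow B hB]
    exact h1 _
  · have e : ∀ y, (inner ℂ (B (B y)) y).re ≤ (inner ℂ (B y) y).re := by
      intro y
      have a1 := h1 (B y)
      have a2 := h0 (y - B y)
      simp only [map_sub, inner_sub_left, inner_sub_right, Complex.sub_re] at a2
      have e1 : inner ℂ (B y) (B y) = inner ℂ (B (B y)) y := (hB _ _).symm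
      rw [e1] at a1 a2
      have e2 : inner ℂ (B (B y)) (B y) = inner ℂ (B (B (B y))) y := (hB _ _).symm
      rw [e2] at a1 a2
      linarith
    have f1 : (B ^ (2 * l + 1 + 1)) x = (B ^ l) (B (B ((B ^ l) x))) := by
      rw [show 2 * l + 1 + 1 = l + (1 + (1 + l)) by ring, pow_add_app, pow_add_app, pow_add_app,
        pow_one]
    have f2 : (B ^ (2 * l + 1)) x = (B ^ l) (B ((B ^ l) x)) := by
      rw [show 2 * l + 1 = l + (1 + l) by ring, pow_add_app, pow_add_app, pow_one]
    rw [f1, f2, symm_pow B hB, symm_pow B hB]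
    have := e ((B ^ l) x)
    exact this

/-- If `N x = a + b` where all powers of `N` keep `a` and `b` orthogonal, then `a` is in the
range of the normal operator `N`. -/
lemma range_of_orthogonal (N : K →L[ℂ] K) (hN : IsStarNormal N) (x a b : K) (hx : N x = a + b)
    (hab : ∀ n : ℕ, inner ℂ ((N ^ n) a) ((N ^ n) b) = 0) : ∃ z, N z = a := by
  set c : ℝ := ‖N‖ ^ 2 + 1 with hc
  have hcp : 0 < c := by positivity
  have hc0 : (c : ℂ) ≠ 0 := by exact_mod_cast hcp.ne'
  set T : K →L[ℂ] K := (ContinuousLinearMap.adjoint N) * N with hT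
  have hTin : ∀ x y, inner ℂ (T x) y = inner ℂ (N x) (N y) := fun x y =>
    ContinuousLinearMap.adjoint_inner_left N y (N x)
  have hTin' : ∀ x y, inner ℂ x (T y) = inner ℂ (N x) (N y) := fun x y =>
    ContinuousLinearMap.adjoint_inner_right N x (N y)
  have hNT : Commute N T := by
    have := hN.star_comm_self
    rw [ContinuousLinearMap.star_eq_adjoint] at this
    exact (this.symm.mul_right (Commute.refl N))
  set B : K →L[ℂ] K := 1 - (c : ℂ)⁻¹ • T with hBdef
  have hBapp : ∀ x, B x = x - (c : ℂ)⁻¹ • T x := fun x => rfl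
  have hNB : Commute N B := (Commute.one_right N).sub_right (hNT.smul_right _)
  have hTB : Commute T B := (Commute.one_right T).sub_right ((Commute.refl T).smul_right _)
  have hB : ∀ x y, inner ℂ (B x) y = inner ℂ x (B y) := by
    intro x y
    simp only [hBapp, inner_sub_left, inner_sub_right, inner_smul_left, inner_smul_right, hTin,
      hTin']
    simp
  have hBre : ∀ x, (inner ℂ (B x) x).re = ‖x‖ ^ 2 - c⁻¹ * ‖N x‖ ^ 2 := by
    intro x
    rw [hBapp, inner_sub_left, inner_smul_left, hTin, ← Complex.ofReal_inv, Complex.conj_ofReal,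
      Complex.sub_re, Complex.re_ofReal_mul, re_inner_self, re_inner_self]
  have h0 : ∀ x, 0 ≤ (inner ℂ (B x) x).re := by
    intro x
    rw [hBre, sub_nonneg, inv_mul_le_iff₀ hcp]
    calc ‖N x‖ ^ 2 ≤ (‖N‖ * ‖x‖) ^ 2 := by gcongr; exact N.le_opNorm x
      _ = ‖N‖ ^ 2 * ‖x‖ ^ 2 := by ring
      _ ≤ _ := by rw [hc]; gcongr; linarith
  have h1 : ∀ x, (inner ℂ (B x) x).re ≤ (inner ℂ x x).re := by
    intro x
    rw [hBre, re_inner_self]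
    simp only [sub_le_self_iff]
    positivity
  -- powers of T and B
  have hTpow : ∀ (n : ℕ) x y, inner ℂ ((T ^ n) x) y = inner ℂ ((N ^ n) x) ((N ^ n) y) := by
    intro n
    induction n with
    | zero => intro x y; simp
    | succ n ih =>
      intro x y
      rw [pow_succ', mul_apply_eq_comp, hTin]
      have e : N ((T ^ n) x) = (T ^ n) (N x) :=
        congrArg (fun A : K →L[ℂ] K => A x) (hNT.pow_right n).eq
      rw [e, ih, pow_succ]
      rfl
  have hBab : ∀ n l : ℕ, inner ℂ ((B ^ n) ((T ^ l) a)) b = 0 := by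
    intro n
    induction n with
    | zero => intro l; rw [pow_zero, one_apply_eq_self, hTpow, hab]
    | succ n ih =>
      intro l
      rw [pow_succ, mul_apply_eq_comp, hBapp, map_sub, map_smul, inner_sub_left,
        inner_smul_left, ih, ← mul_apply_eq_comp T, ← pow_succ', ih]
      simp
  have hBab0 : ∀ n : ℕ, inner ℂ ((B ^ n) a) b = 0 := fun n => by simpa using hBab n 0
  have hBba0 : ∀ n : ℕ, inner ℂ ((B ^ n) b) a = 0 := fun n => by
    rw [symm_pow B hB, ← inner_conj_symm, hBab0, map_zero]
  set s : ℕ → ℝ := fun n => (inner ℂ ((B ^ n) a) a).re with hs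
  have hs0 : ∀ n, 0 ≤ s n := fun n => contr_pow_nonneg B hB h0 n a
  have hsanti : Antitone s := contr_pow_anti B hB h0 h1 a
  have hse : ∀ n, s n ≤ (inner ℂ ((B ^ n) (N x)) (N x)).re := by
    intro n
    rw [hx, map_add, inner_add_left, inner_add_right, inner_add_right, hBab0, hBba0]
    have := contr_pow_nonneg B hB h0 n b
    simp only [add_zero, zero_add, Complex.add_re]
    linarith
  -- telescoping
  have hBN : ∀ n y, (B ^ n) (N y) = N ((B ^ n) y) := fun n y =>
    (congrArg (fun A : K →L[ℂ] K => A y) (hNB.pow_right n).eq).symm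
  have hTc : ∀ y, T y = (c : ℂ) • (y - B y) := by
    intro y; rw [hBapp, sub_sub_cancel, smul_smul, mul_inv_cancel₀ hc0, one_smul]
  have htel : ∀ n, (inner ℂ ((B ^ n) (N x)) (N x)).re =
      c * ((inner ℂ ((B ^ n) x) x).re - (inner ℂ ((B ^ (n + 1)) x) x).re) := by
    intro n
    rw [hBN, ← hTin, hTc, inner_smul_left, inner_sub_left, pow_succ', Complex.conj_ofReal,
      Complex.re_ofReal_mul, Complex.sub_re]
    rfl
  have hsum : ∀ n, ∑ i ∈ Finset.range n, s i ≤ c * ‖x‖ ^ 2 := by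
    intro n
    calc ∑ i ∈ Finset.range n, s i ≤ ∑ i ∈ Finset.range n, c * ((inner ℂ ((B ^ i) x) x).re
            - (inner ℂ ((B ^ (i + 1)) x) x).re) :=
          Finset.sum_le_sum fun i _ => (hse i).trans_eq (htel i)
      _ = c * ((inner ℂ ((B ^ 0) x) x).re - (inner ℂ ((B ^ n) x) x).re) := by
          rw [← Finset.mul_sum, Finset.sum_range_sub']
      _ ≤ _ := by
          have := contr_pow_nonneg B hB h0 n x
          refine mul_le_mul_of_nonneg_left ?_ hcp.le
          rw [pow_zero, one_apply_eq_self, re_inner_self]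
          linarith
  have hsummable : Summable s := summable_of_sum_range_le hs0 hsum
  -- the approximants
  set Z : ℕ → K := fun M => (c : ℂ)⁻¹ • ContinuousLinearMap.adjoint N
    (∑ n ∈ Finset.range M, (B ^ n) a) with hZ
  have hNZ : ∀ M, N (Z M) = a - (B ^ M) a := by
    intro M
    rw [hZ]
    simp only [map_smul]
    rw [normal_comm N hN]
    change (c : ℂ)⁻¹ • T _ = _
    rw [hTc, smul_smul, inv_mul_cancel₀ hc0, one_smul, map_sum, ← Finset.sum_sub_distrib]
    have : ∀ n, (B ^ n) a - B ((B ^ n) a) = (B ^ n) a - (B ^ (n + 1)) a := by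
      intro n; rw [pow_succ']; rfl
    simp only [this]
    rw [Finset.sum_range_sub' (fun n => (B ^ n) a)]
    simp
  have hdiff : ∀ L M, L ≤ M → ‖Z M - Z L‖ ^ 2 ≤ c⁻¹ * (∑ i ∈ Finset.Ico L M, s i) := by
    intro L M hLM
    set A : K := ∑ n ∈ Finset.Ico L M, (B ^ n) a with hA
    have e1 : Z M - Z L = (c : ℂ)⁻¹ • ContinuousLinearMap.adjoint N A := by
      rw [hZ, hA, Finset.sum_Ico_eq_sub _ hLM]
      simp only [map_sub, smul_sub]
    have e2 : ‖ContinuousLinearMap.adjoint N A‖ = ‖N A‖ :=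
      (ContinuousLinearMap.isStarNormal_iff_norm_eq_adjoint.1 hN A).symm
    have e3 : ‖N A‖ ^ 2 = (inner ℂ (T A) A).re := by
      rw [hTin, re_inner_self]
    have e4 : T A = (c : ℂ) • ((B ^ L) a - (B ^ M) a) := by
      rw [hTc, hA, map_sum, ← Finset.sum_sub_distrib]
      have : ∀ n, (B ^ n) a - B ((B ^ n) a) = (B ^ n) a - (B ^ (n + 1)) a := by
        intro n; rw [pow_succ']; rfl
      simp only [this]
      rw [Finset.sum_Ico_eq_sub _ hLM, Finset.sum_range_sub' (fun n => (B ^ n) a),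
        Finset.sum_range_sub' (fun n => (B ^ n) a)]
      congr 1
      abel
    have e5 : ∀ l n : ℕ, (inner ℂ ((B ^ l) a) ((B ^ n) a)).re = s (n + l) := by
      intro l n
      rw [← symm_pow B hB, ← pow_add_app]
    have e6 : (inner ℂ (T A) A).re ≤ c * ∑ i ∈ Finset.Ico L M, s i := by
      rw [e4, inner_smul_left, Complex.conj_ofReal, Complex.re_ofReal_mul]
      refine mul_le_mul_of_nonneg_left ?_ hcp.le
      rw [hA, inner_sum, Complex.re_sum]
      refine Finset.sum_le_sum fun i _ => ?_
      rw [inner_sub_left, Complex.sub_re, e5, e5]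
      have := hs0 (i + M)
      have := hsanti (Nat.le_add_right i L)
      linarith
    rw [e1, norm_smul, mul_pow, e2, e3]
    have e7 : ‖(c : ℂ)⁻¹‖ = c⁻¹ := by rw [norm_inv, Complex.norm_real, Real.norm_of_nonneg hcp.le]
    rw [e7]
    calc c⁻¹ ^ 2 * (inner ℂ (T A) A).re ≤ c⁻¹ ^ 2 * (c * ∑ i ∈ Finset.Ico L M, s i) :=
          mul_le_mul_of_nonneg_left e6 (by positivity)
      _ = _ := by field_simp
  have hcau : CauchySeq Z := by
    have hcs : CauchySeq (fun n => ∑ i ∈ Finset.range n, s i) :=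
      hsummable.hasSum.tendsto_sum_nat.cauchySeq
    rw [Metric.cauchySeq_iff'] at hcs ⊢
    intro ε hε
    obtain ⟨n0, hn0⟩ := hcs (c * ε ^ 2) (by positivity)
    refine ⟨n0, fun n hn => ?_⟩
    have h := hn0 n hn
    rw [Real.dist_eq, ← Finset.sum_Ico_eq_sub _ hn] at h
    have h' := (le_abs_self _).trans_lt h
    have h2 := hdiff n0 n hn
    rw [dist_eq_norm]
    have h3 : ‖Z n - Z n0‖ ^ 2 < ε ^ 2 := by
      refine h2.trans_lt ?_
      rw [inv_mul_lt_iff₀ hcp]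
      exact h'
    exact lt_of_pow_lt_pow_left₀ 2 hε.le h3
  obtain ⟨z, hz⟩ := cauchySeq_tendsto_of_complete hcau
  refine ⟨z, ?_⟩
  have l1 : Filter.Tendsto (fun M => N (Z M)) Filter.atTop (nhds (N z)) :=
    (N.continuous.tendsto z).comp hz
  have l2 : Filter.Tendsto (fun M => (B ^ M) a) Filter.atTop (nhds 0) := by
    rw [tendsto_zero_iff_norm_tendsto_zero]
    have e : ∀ M, ‖(B ^ M) a‖ = Real.sqrt (s (M + M)) := by
      intro M
      have : s (M + M) = ‖(B ^ M) a‖ ^ 2 := by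
        simp only [hs]
        rw [pow_add_app, symm_pow B hB, re_inner_self]
      rw [this, Real.sqrt_sq (norm_nonneg _)]
    simp only [e]
    have t1 : Filter.Tendsto (fun M : ℕ => M + M) Filter.atTop Filter.atTop :=
      Filter.tendsto_atTop_mono (fun n => Nat.le_add_left n n) Filter.tendsto_id
    have t2 := hsummable.tendsto_atTop_zero.comp t1
    have t3 := (Real.continuous_sqrt.tendsto 0).comp t2
    rw [Real.sqrt_zero] at t3
    exact t3
  have l3 : Filter.Tendsto (fun M => N (Z M)) Filter.atTop (nhds (a - 0)) := by
    simp only [hNZ]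
    exact tendsto_const_nhds.sub l2
  rw [sub_zero] at l3
  exact tendsto_nhds_unique l1 l3

end range

/-! ### Operators on Hilbert sums -/

lemma hasSum_norm_sq {ι : Type*} {G : ι → Type*} [∀ i, NormedAddCommGroup (G i)]
    (f : lp G 2) : HasSum (fun i => ‖f i‖ ^ 2) (‖f‖ ^ 2) := by
  have := lp.hasSum_norm (p := 2) (by norm_num) f
  simpa using this

lemma memlp_two {ι : Type*} {G : ι → Type*} [∀ i, NormedAddCommGroup (G i)]
    {f : ∀ i, G i} (h : Summable (fun i => ‖f i‖ ^ 2)) : Memℓp f 2 := by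
  apply memℓp_gen
  simpa using h

section ops
variable {ι : Type*} {G : ι → Type*} [∀ i, NormedAddCommGroup (G i)]
  [∀ i, InnerProductSpace ℂ (G i)]

lemma opL_aux (σ : ι → ι) (hσ : Function.Injective σ) (A : ∀ i, G (σ i) →L[ℂ] G i) (C : ℝ)
    (hC : ∀ i, ‖A i‖ ≤ C) (f : lp G 2) :
    Summable (fun i => ‖A i (f (σ i))‖ ^ 2) ∧
      ∑' i, ‖A i (f (σ i))‖ ^ 2 ≤ (C * ‖f‖) ^ 2 := by
  have hs := hasSum_norm_sq f
  have hs1 : Summable (fun i => ‖f (σ i)‖ ^ 2) := hs.summable.comp_injective hσ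
  have hle : ∀ i, ‖A i (f (σ i))‖ ^ 2 ≤ C ^ 2 * ‖f (σ i)‖ ^ 2 := by
    intro i
    rw [← mul_pow]
    gcongr
    exact (A i).le_of_opNorm_le (hC i) _
  have hs2 : Summable (fun i => ‖A i (f (σ i))‖ ^ 2) :=
    Summable.of_nonneg_of_le (fun i => by positivity) hle (hs1.mul_left _)
  refine ⟨hs2, ?_⟩
  calc _ ≤ ∑' i, C ^ 2 * ‖f (σ i)‖ ^ 2 := hs2.tsum_le_tsum hle (hs1.mul_left _)
    _ = C ^ 2 * ∑' i, ‖f (σ i)‖ ^ 2 := tsum_mul_left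
    _ ≤ C ^ 2 * ∑' i, ‖f i‖ ^ 2 := by
      refine mul_le_mul_of_nonneg_left ?_ (by positivity)
      exact hs1.tsum_le_tsum_of_inj σ hσ (fun _ _ => by positivity) (fun _ => le_rfl) hs.summable
    _ = _ := by rw [hs.tsum_eq, mul_pow]

/-- the operator `(F f) i = A i (f (σ i))` on the Hilbert sum -/
def opL (σ : ι → ι) (hσ : Function.Injective σ) (A : ∀ i, G (σ i) →L[ℂ] G i) (C : ℝ)
    (hC : ∀ i, ‖A i‖ ≤ C) : lp G 2 →L[ℂ] lp G 2 :=
  LinearMap.mkContinuous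
    { toFun := fun f => ⟨fun i => A i (f (σ i)), memlp_two (opL_aux σ hσ A C hC f).1⟩
      map_add' := fun f g => by ext i; simp; rfl
      map_smul' := fun c f => by ext i; simp } |C| (fun f => by
      have h := (opL_aux σ hσ A C hC f).2
      have h2 := hasSum_norm_sq
        (⟨fun i => A i (f (σ i)), memlp_two (opL_aux σ hσ A C hC f).1⟩ : lp G 2)
      rw [h2.tsum_eq] at h
      have h3 := sq_le_sq.1 h
      rwa [abs_norm, abs_mul, abs_norm] at h3)

lemma opL_apply (σ : ι → ι) (hσ : Function.Injective σ) (A : ∀ i, G (σ i) →L[ℂ] G i) (C : ℝ)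
    (hC : ∀ i, ‖A i‖ ≤ C) (f : lp G 2) (i : ι) : opL σ hσ A C hC f i = A i (f (σ i)) := rfl

lemma diag_normal [∀ i, CompleteSpace (G i)] (A : ∀ i, G i →L[ℂ] G i) (C : ℝ)
    (hC : ∀ i, ‖A i‖ ≤ C) (hA : ∀ i, IsStarNormal (A i)) :
    IsStarNormal (opL id Function.injective_id A C hC) := by
  have hC' : ∀ i, ‖ContinuousLinearMap.adjoint (A i)‖ ≤ C := fun i => by
    rw [LinearIsometryEquiv.norm_map]; exact hC i
  have hinst : CompleteSpace (lp G 2) := inferInstance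
  refine isStarNormal_of_adj _
    (opL id Function.injective_id (fun i => ContinuousLinearMap.adjoint (A i)) C hC') ?_ ?_
  · intro x y
    rw [lp.inner_eq_tsum, lp.inner_eq_tsum]
    refine tsum_congr fun i => ?_
    rw [opL_apply, opL_apply]
    exact (ContinuousLinearMap.adjoint_inner_right (A i) _ _).symm
  · intro x
    ext i
    simp only [opL_apply]
    exact normal_comm (A i) (hA i) (x i)
end ops

section shiftZ
variable {K : Type u} [NormedAddCommGroup K] [InnerProductSpace ℂ K]

/-- the operator `N ⊗ U` on `ℓ²(ℤ, K)`, `U` being the bilateral shift -/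
def tensU (N : K →L[ℂ] K) : lp (fun _ : ℤ => K) 2 →L[ℂ] lp (fun _ : ℤ => K) 2 :=
  opL (fun i => i - 1) (sub_left_injective) (fun _ => N) ‖N‖ (fun _ => le_rfl)

lemma tensU_apply (N : K →L[ℂ] K) (f : lp (fun _ : ℤ => K) 2) (i : ℤ) :
    tensU N f i = N (f (i - 1)) := rfl

lemma tensU_normal [CompleteSpace K] (N : K →L[ℂ] K) (hN : IsStarNormal N) :
    IsStarNormal (tensU N) := by
  refine isStarNormal_of_adj _
    (opL (G := fun _ : ℤ => K) (fun i : ℤ => i + 1) (add_left_injective 1)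
      (fun i => ContinuousLinearMap.adjoint N) ‖ContinuousLinearMap.adjoint N‖
      (fun _ => le_rfl)) ?_ ?_
  · intro x y
    rw [lp.inner_eq_tsum, lp.inner_eq_tsum, ← (Equiv.addRight (1 : ℤ)).tsum_eq]
    refine tsum_congr fun i => ?_
    rw [opL_apply, tensU_apply, ContinuousLinearMap.adjoint_inner_right]
    simp
  · intro x
    ext i
    simp only [opL_apply, tensU_apply]
    rw [normal_comm N hN]
    simp

lemma tensU_single (N : K →L[ℂ] K) (i : ℤ) (x : K) :
    tensU N (lp.single 2 i x) = lp.single 2 (i + 1) (N x) := by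
  ext l
  rw [tensU_apply, lp.single_apply, lp.single_apply]
  by_cases h : l = i + 1
  · subst h; simp
  · have h' : l - 1 ≠ i := fun h' => h (by omega)
    rw [Pi.single_eq_of_ne h, Pi.single_eq_of_ne h', map_zero]
end shiftZ

/-! ### Realizations of weighted shifts -/

section realize
variable {K : Type*} [NormedAddCommGroup K] [InnerProductSpace ℂ K]

/-- the orthonormal family `b` realizes the weighted shift with parent function `q` and weights
`lam` as a part of the operator `N`. -/
def Realizes {W : Type u} (q : W → W) (lam : W → ℂ) (N : K →L[ℂ] K) (b : W → K) : Prop :=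
  Orthonormal ℂ b ∧ ∀ w, HasSum (fun u => if q u = w then lam u • b u else 0) (N (b w))

lemma ev_apply {W : Type u} (w v : W) : (ev w : ∀ _ : W, ℂ) v = if v = w then 1 else 0 := by
  rw [ev, lp.single_apply, Pi.single_apply]

lemma inner_ev {W : Type u} (w : W) (f : Hs W) :
    inner ℂ (ev w) f = (f : ∀ _ : W, ℂ) w := by
  rw [ev, lp.inner_single_left]; simp

lemma ev_orthonormal {W : Type u} : Orthonormal ℂ (ev : W → Hs W) := by
  rw [orthonormal_iff_ite]
  intro i j
  rw [inner_ev, ev_apply]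

lemma hs_ext {W : Type u} {F : Type*} [NormedAddCommGroup F] [NormedSpace ℂ F]
    (A B : Hs W →L[ℂ] F) (h : ∀ w, A (ev w) = B (ev w)) (f : Hs W) : A f = B f := by
  have e : A = B := by
    refine lp.ext_continuousLinearMap (by norm_num) fun w => ?_
    refine ContinuousLinearMap.ext_ring ?_
    exact h w
  rw [e]

/-- the isometry defined by an orthonormal family -/
def onIso [CompleteSpace K] {W : Type u} {b : W → K} (hb : Orthonormal ℂ b) : Hs W →ₗᵢ[ℂ] K :=
  hb.orthogonalFamily.linearIsometry

lemma onIso_ev [CompleteSpace K] {W : Type u} {b : W → K} (hb : Orthonormal ℂ b) (w : W) :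
    onIso hb (ev w) = b w := by
  rw [onIso, ev, OrthogonalFamily.linearIsometry_apply_single]
  simp

lemma shift_realizes {W : Type u} {q : W → W} {lam : W → ℂ} {A : Hs W →L[ℂ] Hs W}
    (hA : IsWeightedShift q lam A) : Realizes q lam A ev := by
  refine ⟨ev_orthonormal, fun w => ?_⟩
  have h := lp.hasSum_single (p := 2) (by norm_num) (A (ev w))
  convert! h using 2 with u
  rw [hA, ev_apply]
  split_ifs with h
  · rw [mul_one, ev, ← lp.single_smul, smul_eq_mul, mul_one]
  · rw [mul_zero, lp.single_zero]

lemma Realizes.map {W : Type u} {q : W → W} {lam : W → ℂ} {E : Type*} [NormedAddCommGroup E]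
    [InnerProductSpace ℂ E] {A : E →L[ℂ] E} {b : W → E} (h : Realizes q lam A b)
    (J : E →ₗᵢ[ℂ] K) {N : K →L[ℂ] K} (hJ : ∀ x, N (J x) = J (A x)) :
    Realizes q lam N (fun w => J (b w)) := by
  refine ⟨h.1.comp_linearIsometry J, fun w => ?_⟩
  rw [hJ]
  have := (h.2 w).mapL J.toContinuousLinearMap
  convert! this using 2 with u
  split_ifs <;> simp

lemma Realizes.restrict {W X : Type u} {q : W → W} {lam : W → ℂ} {N : K →L[ℂ] K} {b : W → K}
    (h : Realizes q lam N b) {p : X → X} {mu : X → ℂ} (φ : X → W) (hφ : Function.Injective φ)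
    (h1 : ∀ u w, (if q (φ u) = φ w then lam (φ u) else 0) = if p u = w then mu u else 0)
    (h2 : ∀ u, u ∉ Set.range φ → ∀ w, q u ≠ φ w) : Realizes p mu N (fun x => b (φ x)) := by
  refine ⟨h.1.comp φ hφ, fun w => ?_⟩
  have := h.2 (φ w)
  rw [← hφ.hasSum_iff] at this
  · convert! this using 2 with u
    have := h1 u w
    simp only [Function.comp]
    split_ifs at this ⊢ <;> simp_all
  · intro u hu
    rw [if_neg (h2 u hu w)]

lemma Realizes.inner_basis {W : Type u} {q : W → W} {lam : W → ℂ} {N : K →L[ℂ] K} {b : W → K}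
    (h : Realizes q lam N b) (v w : W) :
    inner ℂ (b v) (N (b w)) = if q v = w then lam v else 0 := by
  have h1 := (h.2 w).mapL (innerSL ℂ (b v))
  have h2 := hasSum_single (f := fun u => innerSL ℂ (b v) (if q u = w then lam u • b u else 0)) v (by
    intro u hu
    split_ifs
    · simp [h.1.2 hu.symm]
    · simp)
  have h3 := h1.unique h2
  simp only [innerSL_apply_apply] at h3
  rw [h3]
  split_ifs
  · rw [inner_smul_right, inner_self_eq_norm_sq_to_K, h.1.1]; simp
  · simp

lemma Realizes.exists_shift [CompleteSpace K] {W : Type u} {q : W → W} {lam : W → ℂ}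
    {N : K →L[ℂ] K} {b : W → K} (h : Realizes q lam N b) :
    ∃ A : Hs W →L[ℂ] Hs W, IsWeightedShift q lam A := by
  let J := (onIso h.1).toContinuousLinearMap
  let A : Hs W →L[ℂ] Hs W := (ContinuousLinearMap.adjoint J).comp (N.comp J)
  refine ⟨A, fun f v => ?_⟩
  let F1 : Hs W →L[ℂ] ℂ := (innerSL ℂ (ev v)).comp A
  let F2 : Hs W →L[ℂ] ℂ := lam v • innerSL ℂ (ev (q v))
  have key := hs_ext F1 F2 (fun w => by
    change inner ℂ (ev v) (ContinuousLinearMap.adjoint J (N (J (ev w)))) =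
      lam v * inner ℂ (ev (q v)) (ev w)
    rw [ContinuousLinearMap.adjoint_inner_right, inner_ev, ev_apply]
    change inner ℂ (onIso h.1 (ev v)) (N (onIso h.1 (ev w))) = _
    rw [onIso_ev, onIso_ev, h.inner_basis]
    split_ifs <;> simp) f
  have e1 : F1 f = (A f : ∀ _ : W, ℂ) v := inner_ev v (A f)
  have e2 : F2 f = lam v * (f : ∀ _ : W, ℂ) (q v) := by
    change lam v * inner ℂ (ev (q v)) f = _
    rw [inner_ev]
  rw [← e1, ← e2, key]

lemma Realizes.intertwine [CompleteSpace K] {W : Type u} {q : W → W} {lam : W → ℂ}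
    {N : K →L[ℂ] K} {b : W → K} (h : Realizes q lam N b) {A : Hs W →L[ℂ] Hs W}
    (hA : IsWeightedShift q lam A) (f : Hs W) : N (onIso h.1 f) = onIso h.1 (A f) := by
  let J := (onIso h.1).toContinuousLinearMap
  refine hs_ext (N.comp J) (J.comp A) (fun w => ?_) f
  change N (onIso h.1 (ev w)) = onIso h.1 (A (ev w))
  rw [onIso_ev]
  refine (h.2 w).unique ?_
  have := ((shift_realizes hA).2 w).mapL J
  convert! this using 2 with u
  split_ifs
  · rw [map_smul]
    change _ = lam u • onIso h.1 (ev u)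
    rw [onIso_ev]
  · simp

end realize

lemma Realizes.subnormal {K : Type u} [NormedAddCommGroup K] [InnerProductSpace ℂ K]
    [CompleteSpace K] {W : Type u} {q : W → W} {lam : W → ℂ}
    {N : K →L[ℂ] K} {b : W → K} (h : Realizes q lam N b) (hN : IsStarNormal N)
    {A : Hs W →L[ℂ] Hs W} (hA : IsWeightedShift q lam A) : Subnormal A :=
  ⟨K, inferInstance, inferInstance, inferInstance, onIso h.1, N, hN, h.intertwine hA⟩

lemma Realizes.norm_le {K : Type u} [NormedAddCommGroup K] [InnerProductSpace ℂ K]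
    [CompleteSpace K] {W : Type u} {q : W → W} {lam : W → ℂ}
    {N : K →L[ℂ] K} {b : W → K} (h : Realizes q lam N b)
    {A : Hs W →L[ℂ] Hs W} (hA : IsWeightedShift q lam A) : ‖A‖ ≤ ‖N‖ := by
  refine ContinuousLinearMap.opNorm_le_bound _ (norm_nonneg _) fun f => ?_
  rw [← (onIso h.1).norm_map (A f), ← h.intertwine hA, ← (onIso h.1).norm_map f]
  exact N.le_opNorm _


/-! ### Norm estimate -/

lemma norm_le_of_blocks {J : Type u} {V : J → Type u} (p : ∀ j, V j → V j) (lam : ∀ j, V j → ℂ)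
    (S : ∀ j, Hs (V j) →L[ℂ] Hs (V j)) (hS : ∀ j, IsWeightedShift (p j) (lam j) (S j))
    {C : ℝ} (hC0 : 0 ≤ C) (hC : ∀ j, ‖S j‖ ≤ C) {W : Type u} (φ : (Σ j, V j) → W)
    (hφ : Function.Injective φ) (g g' : Hs W) (h0 : ∀ w, w ∉ Set.range φ → g' w = 0)
    (h1 : ∀ j v, g' (φ ⟨j, v⟩) = lam j v * g (φ ⟨j, p j v⟩)) : ‖g'‖ ≤ C * ‖g‖ := by
  have hsg := hasSum_norm_sq g
  have hsg' := hasSum_norm_sq g'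
  have s1 : HasSum (fun x => ‖g' (φ x)‖ ^ 2) (‖g'‖ ^ 2) := by
    rw [← hφ.hasSum_iff] at hsg'
    · exact hsg'
    · intro w hw; rw [h0 w hw]; simp
  have s2 : Summable (fun x => ‖g (φ x)‖ ^ 2) := hsg.summable.comp_injective hφ
  have s2le : ∑' x, ‖g (φ x)‖ ^ 2 ≤ ‖g‖ ^ 2 := by
    rw [← hsg.tsum_eq]
    exact s2.tsum_le_tsum_of_inj φ hφ (fun _ _ => by positivity) (fun _ => le_rfl) hsg.summable
  have s3 : ∀ j, Summable (fun v => ‖g (φ ⟨j, v⟩)‖ ^ 2) := fun j =>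
    s2.comp_injective (sigma_mk_injective (i := j))
  let G : ∀ j, Hs (V j) := fun j => ⟨fun v => g (φ ⟨j, v⟩), memlp_two (s3 j)⟩
  have s4 : HasSum (fun j => ‖G j‖ ^ 2) (∑' x, ‖g (φ x)‖ ^ 2) :=
    s2.hasSum.sigma (fun j => hasSum_norm_sq (G j))
  have s5 : HasSum (fun j => ‖S j (G j)‖ ^ 2) (‖g'‖ ^ 2) := by
    refine s1.sigma (fun j => ?_)
    have := hasSum_norm_sq (S j (G j))
    convert! this using 3 with v
    rw [h1, hS]
  have s6 : ‖g'‖ ^ 2 ≤ C ^ 2 * ∑' x, ‖g (φ x)‖ ^ 2 := by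
    refine hasSum_le (fun j => ?_) s5 (s4.mul_left (C ^ 2))
    rw [← mul_pow]
    gcongr
    exact (S j).le_of_opNorm_le (hC j) _
  have s7 : ‖g'‖ ^ 2 ≤ (C * ‖g‖) ^ 2 := by
    rw [mul_pow]
    exact s6.trans (mul_le_mul_of_nonneg_left s2le (by positivity))
  exact (sq_le_sq₀ (norm_nonneg _) (by positivity)).1 s7

/-! ### Backward extensions -/

/-- the canonical isometric embedding of a summand into the Hilbert sum -/
def sgL {ι : Type*} {G : ι → Type*} [∀ i, NormedAddCommGroup (G i)]
    [∀ i, InnerProductSpace ℂ (G i)] (i : ι) : G i →ₗᵢ[ℂ] lp G 2 where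
  toLinearMap := lp.lsingle 2 i
  norm_map' := fun x => lp.norm_single (by norm_num) i x

lemma sgL_eq {ι : Type*} {G : ι → Type*} [∀ i, NormedAddCommGroup (G i)]
    [∀ i, InnerProductSpace ℂ (G i)] (i : ι) (x : G i) : sgL i x = lp.single 2 i x := rfl

lemma inner_sgL_self {ι : Type*} {G : ι → Type*} [∀ i, NormedAddCommGroup (G i)]
    [∀ i, InnerProductSpace ℂ (G i)] (i : ι) (x y : G i) :
    inner ℂ (sgL i x) (sgL i y) = inner ℂ x y := LinearIsometry.inner_map_map _ _ _

lemma inner_sgL_ne {ι : Type*} {G : ι → Type*} [∀ i, NormedAddCommGroup (G i)]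
    [∀ i, InnerProductSpace ℂ (G i)] (i j : ι) (hij : i ≠ j) (x : G i) (y : G j) :
    inner ℂ (sgL i x) (sgL j y) = 0 := by
  rw [sgL_eq, sgL_eq, lp.inner_single_left, lp.single_apply, Pi.single_eq_of_ne hij,
    inner_zero_right]

lemma inner_sgL {K : Type u} [NormedAddCommGroup K] [InnerProductSpace ℂ K]
    (i j : ℤ) (x y : K) :
    inner ℂ (sgL (G := fun _ : ℤ => K) i x) (sgL (G := fun _ : ℤ => K) j y) =
      if i = j then inner ℂ x y else 0 := by
  split_ifs with h
  · subst h; exact inner_sgL_self (G := fun _ : ℤ => K) i x y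
  · exact inner_sgL_ne (G := fun _ : ℤ => K) i j h x y

lemma tensU_sgL {K : Type u} [NormedAddCommGroup K] [InnerProductSpace ℂ K]
    (N : K →L[ℂ] K) (i : ℤ) (x : K) :
    tensU N (sgL (G := fun _ : ℤ => K) i x) = sgL (G := fun _ : ℤ => K) (i + 1) (N x) := by
  rw [sgL_eq, sgL_eq]
  convert! tensU_single N i x

lemma backExt {K : Type u} [NormedAddCommGroup K] [InnerProductSpace ℂ K] [CompleteSpace K]
    (N : K →L[ℂ] K) (hN : IsStarNormal N) {V : Type u} {p : V → V} {lam : V → ℂ} {ω : V}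
    (hlam : lam ω = 0) (d : V → ℕ) (hd : ∀ v, v ≠ ω → d v = d (p v) + 1) (hd0 : d ω = 0)
    {b : V → K} (hb : Realizes p lam N b) (k : ℕ) (Z : K) (β : ℂ) (hβ : β ≠ 0)
    (hZ : (N ^ k) Z = β • b ω) :
    ∃ mu : Fin k → ℂ, (∀ j, mu j ≠ 0) ∧
      ∃ S' : Hs (V ⊕ Fin k) →L[ℂ] Hs (V ⊕ Fin k),
        IsWeightedShift (extParent p ω k) (extWeights lam ω k mu) S' ∧ Subnormal S' := by
  have hbω : b ω ≠ 0 := hb.1.ne_zero ω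
  let Y : ℕ → K := fun i => (N ^ (k - 1 - i)) Z
  have hY0 : 0 < k → N (Y 0) = β • b ω := by
    intro hk
    rw [← hZ]
    change (N * N ^ (k - 1 - 0)) Z = _
    rw [← pow_succ']
    congr 2
    omega
  have hYs : ∀ i, i + 1 < k → N (Y (i + 1)) = Y i := by
    intro i hi
    change (N * N ^ (k - 1 - (i + 1))) Z = (N ^ (k - 1 - i)) Z
    rw [← pow_succ']
    congr 2
    omega
  have hYne : ∀ i, i < k → Y i ≠ 0 := by
    intro i hi h0
    have : (N ^ (i + 1)) (Y i) = β • b ω := by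
      rw [← hZ]
      change (N ^ (i + 1) * N ^ (k - 1 - i)) Z = _
      rw [← pow_add]
      congr 2
      omega
    rw [h0, map_zero] at this
    exact smul_ne_zero hβ hbω this.symm
  clear_value Y
  let ν : ℕ → ℂ := fun i => (‖Y i‖ : ℂ)
  have hν : ∀ i, i < k → ν i ≠ 0 := fun i hi => by
    simpa [ν] using hYne i hi
  let mu : Fin k → ℂ := fun i => if (i : ℕ) = 0 then β / ν 0 else ν (i - 1) / ν i
  have hmu : ∀ i, mu i ≠ 0 := by
    intro i
    simp only [mu]
    have hi := i.2
    split_ifs with h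
    · exact div_ne_zero hβ (hν _ (by omega))
    · exact div_ne_zero (hν _ (by omega)) (hν _ hi)
  let sg : ℤ → K →ₗᵢ[ℂ] lp (fun _ : ℤ => K) 2 := fun i => sgL (G := fun _ : ℤ => K) i
  have sg_inner : ∀ i j x y, inner ℂ (sg i x) (sg j y) = if i = j then inner ℂ x y else 0 :=
    inner_sgL
  have sg_N : ∀ i x, tensU N (sg i x) = sg (i + 1) (N x) := tensU_sgL N
  clear_value sg
  let B : V ⊕ Fin k → lp (fun _ : ℤ => K) 2 := fun w => match w with
    | Sum.inl v => sg (d v : ℤ) (b v)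
    | Sum.inr i => sg (-((i : ℕ) + 1 : ℤ)) ((ν i)⁻¹ • Y i)
  have hBon : Orthonormal ℂ B := by
    constructor
    · rintro (v | i)
      · change ‖sg (d v : ℤ) (b v)‖ = 1
        rw [LinearIsometry.norm_map]
        exact hb.1.1 v
      · change ‖sg (-((i : ℕ) + 1 : ℤ)) ((ν i)⁻¹ • Y i)‖ = 1
        rw [LinearIsometry.norm_map, norm_smul, norm_inv]
        have := norm_ne_zero_iff.2 (hYne i i.2)
        simp [ν, this]
    · rintro (v | i) (v' | i') hne
      · change inner ℂ (sg (d v : ℤ) (b v)) (sg (d v' : ℤ) (b v')) = 0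
        rw [sg_inner]
        split_ifs
        · exact hb.1.2 (fun h => hne (by rw [h]))
        · rfl
      · change inner ℂ (sg (d v : ℤ) (b v))
          (sg (-((i' : ℕ) + 1 : ℤ)) ((ν i')⁻¹ • Y i')) = 0
        rw [sg_inner, if_neg (by omega)]
      · change inner ℂ (sg (-((i : ℕ) + 1 : ℤ)) ((ν i)⁻¹ • Y i))
          (sg (d v' : ℤ) (b v')) = 0
        rw [sg_inner, if_neg (by omega)]
      · change inner ℂ (sg (-((i : ℕ) + 1 : ℤ)) ((ν i)⁻¹ • Y i))
          (sg (-((i' : ℕ) + 1 : ℤ)) ((ν i')⁻¹ • Y i')) = 0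
        rw [sg_inner, if_neg]
        intro h
        exact hne (by congr 1; exact Fin.ext (by omega))
  have hreal : Realizes (extParent p ω k) (extWeights lam ω k mu) (tensU N) B := by
    refine ⟨hBon, ?_⟩
    rintro (v | ⟨i, hi⟩)
    · change HasSum _ (tensU N (sg (d v : ℤ) (b v)))
      rw [sg_N]
      have h1 := (hb.2 v).mapL
        (sg ((d v : ℤ) + 1)).toContinuousLinearMap
      rw [← (Sum.inl_injective (α := V) (β := Fin k)).hasSum_iff]
      · convert! h1 using 2 with u
        simp only [Function.comp, extParent, extWeights, LinearIsometry.coe_toContinuousLinearMap]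
        by_cases hu : u = ω
        · subst hu
          by_cases hk : 0 < k
          · simp [hk, hlam]
          · simp [hk, hlam]
        · simp only [hu, if_false, Sum.inl.injEq]
          split_ifs with hp
          · have := hd u hu
            rw [hp] at this
            change lam u • sg (d u : ℤ) (b u) = _
            rw [map_smul, this]
            push_cast
            rfl
          · rw [map_zero]
      · rintro (u | u) hu
        · exact absurd ⟨u, rfl⟩ hu
        · rw [if_neg]
          simp only [extParent]
          split_ifs <;> simp
    · change HasSum _ (tensU N (sg (-((i : ℕ) + 1 : ℤ)) ((ν i)⁻¹ • Y i)))
      rw [sg_N, map_smul]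
      rcases i with _ | i
      · rw [hY0 hi]
        have hs := hasSum_single (f := fun u => if extParent p ω k u = Sum.inr ⟨0, hi⟩ then
            extWeights lam ω k mu u • B u else 0) (Sum.inl ω) (by
          rintro (u | ⟨u, hu⟩) hne
          · have : u ≠ ω := fun h => hne (by rw [h])
            simp [extParent, this]
          · by_cases h : u + 1 < k
            · simp [extParent, h]
            · simp [extParent, extWeights, h])
        have hp : extParent p ω k (Sum.inl ω) = Sum.inr ⟨0, hi⟩ := by simp [extParent, hi]
        have hq : extWeights lam ω k mu (Sum.inl ω) = mu ⟨0, hi⟩ := by simp [extWeights, hi]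
        have hval : sg (-(((0 : ℕ) : ℤ) + 1) + 1) ((ν 0)⁻¹ • β • b ω) =
            mu ⟨0, hi⟩ • sg (d ω : ℤ) (b ω) := by
          rw [hd0, ← map_smul, smul_smul]
          simp [mu, div_eq_mul_inv, mul_comm]
        rw [if_pos hp, hq] at hs
        rw [hval]
        convert! hs using 2
        split_ifs <;> rfl
      · rw [hYs i hi]
        have hi' : i < k := by omega
        have hs := hasSum_single (f := fun u => if extParent p ω k u = Sum.inr ⟨i + 1, hi⟩ then
            extWeights lam ω k mu u • B u else 0) (Sum.inr ⟨i, hi'⟩) (by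
          rintro (u | ⟨u, hu⟩) hne
          · by_cases h : u = ω
            · simp [extParent, h, show 0 < k by omega]
            · simp [extParent, h]
          · by_cases h : u + 1 < k
            · have : u ≠ i := fun h => hne (by subst h; rfl)
              simp [extParent, h, this]
            · simp [extParent, extWeights, h])
        have hp : extParent p ω k (Sum.inr ⟨i, hi'⟩) = Sum.inr ⟨i + 1, hi⟩ := by
          simp [extParent, hi]
        have hq : extWeights lam ω k mu (Sum.inr ⟨i, hi'⟩) = mu ⟨i + 1, hi⟩ := by
          simp [extWeights, hi]
        have hval : sg (-(((i + 1 : ℕ) : ℤ) + 1) + 1) ((ν (i + 1))⁻¹ • Y i) =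
            mu ⟨i + 1, hi⟩ • sg (-((i : ℕ) + 1 : ℤ)) ((ν i)⁻¹ • Y i) := by
          rw [← map_smul, smul_smul]
          have := hν i hi'
          have e1 : (-(((i + 1 : ℕ) : ℤ) + 1) + 1) = (-((i : ℕ) + 1 : ℤ)) := by push_cast; ring
          rw [e1]
          congr 2
          simp only [mu, Nat.add_sub_cancel]
          rw [if_neg (by omega)]
          field_simp
        rw [if_pos hp, hq] at hs
        rw [hval]
        convert! hs using 2
        split_ifs <;> rfl
  obtain ⟨S', hS'⟩ := hreal.exists_shift
  exact ⟨mu, hmu, S', hS', hreal.subnormal (tensU_normal N hN) hS'⟩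

lemma depth_exists {V : Type u} {p : V → V} {ω : V} (htree : IsDirectedTree p)
    (hroot : p ω = ω) : ∃ d : V → ℕ, (∀ v, v ≠ ω → d v = d (p v) + 1) ∧ d ω = 0 := by
  have hex : ∀ v, ∃ n, p^[n] v = ω := by
    intro v
    obtain ⟨m, n, h⟩ := htree.2 v ω
    exact ⟨m, by rw [h, Function.iterate_fixed hroot]⟩
  refine ⟨fun v => Nat.find (hex v), fun v hv => ?_, ?_⟩
  · have := Nat.find_comp_succ (hex v) (hex (p v)) (by simpa using hv)
    exact this
  · rw [Nat.find_eq_zero]; rfl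

/-! ### Rooted sums and restrictions -/

lemma rs_restrict {J : Type u} {V : J → Type u} {p : ∀ j, V j → V j} {ω : ∀ j, V j}
    {lam : ∀ j, V j → ℂ} (hlam : ∀ j, lam j (ω j) = 0) {θ : J → ℂ}
    {K : Type u} [NormedAddCommGroup K] [InnerProductSpace ℂ K] {N : K →L[ℂ] K}
    {b : Option (Σ j, V j) → K} (h : Realizes (rsParent p ω) (rsWeights lam ω θ) N b) (j : J) :
    Realizes (p j) (lam j) N (fun v => b (some ⟨j, v⟩)) := by
  refine h.restrict (fun v => some ⟨j, v⟩) (fun v v' hv => by simpa using hv) ?_ ?_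
  · intro u w
    by_cases hu : u = ω j
    · subst hu
      simp [rsParent, hlam]
    · simp [rsParent, rsWeights, hu]
  · rintro (_ | ⟨j', v⟩) hu w
    · simp [rsParent]
    · have hne : j' ≠ j := by
        rintro rfl
        exact hu ⟨v, rfl⟩
      by_cases hv : v = ω j'
      · simp [rsParent, hv]
      · simp [rsParent, hv, hne]

lemma ext_restrict {V : Type u} {p : V → V} {ω : V} {lam : V → ℂ} (hlam : lam ω = 0) {k : ℕ}
    {mu : Fin k → ℂ} {K : Type u} [NormedAddCommGroup K] [InnerProductSpace ℂ K] {N : K →L[ℂ] K}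
    {b : V ⊕ Fin k → K} (h : Realizes (extParent p ω k) (extWeights lam ω k mu) N b) :
    Realizes p lam N (fun v => b (Sum.inl v)) := by
  refine h.restrict Sum.inl Sum.inl_injective ?_ ?_
  · intro u w
    by_cases hu : u = ω
    · subst hu
      by_cases hk : 0 < k
      · simp [extParent, hlam, hk]
      · simp [extParent, extWeights, hlam, hk]
    · simp [extParent, extWeights, hu]
  · rintro (v | i) hu w
    · exact absurd ⟨v, rfl⟩ hu
    · simp only [extParent]
      split_ifs <;> simp

lemma rs_norm_le {J : Type u} {V : J → Type u} {p : ∀ j, V j → V j} {ω : ∀ j, V j}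
    {lam : ∀ j, V j → ℂ} (hlam : ∀ j, lam j (ω j) = 0) {θ : J → ℂ}
    (hroot : ∀ j, p j (ω j) = ω j) {S : ∀ j, Hs (V j) →L[ℂ] Hs (V j)}
    (hS : ∀ j, IsWeightedShift (p j) (lam j) (S j))
    {S' : Hs (Option (Σ j, V j)) →L[ℂ] Hs (Option (Σ j, V j))}
    (hS' : IsWeightedShift (rsParent p ω) (rsWeights lam ω θ) S') (j : J) : ‖S j‖ ≤ ‖S'‖ :=
  (rs_restrict hlam (shift_realizes hS') j).norm_le (hS j)

lemma rs_norm {J : Type u} [Nonempty J] {V : J → Type u} {p : ∀ j, V j → V j} {ω : ∀ j, V j}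
    {lam : ∀ j, V j → ℂ} (hlam : ∀ j, lam j (ω j) = 0) {θ : J → ℂ}
    (hroot : ∀ j, p j (ω j) = ω j) {S : ∀ j, Hs (V j) →L[ℂ] Hs (V j)}
    (hS : ∀ j, IsWeightedShift (p j) (lam j) (S j))
    {S' : Hs (Option (Σ j, V j)) →L[ℂ] Hs (Option (Σ j, V j))}
    (hS' : IsWeightedShift (rsParent p ω) (rsWeights lam ω θ) S') (hsub : Subnormal S') :
    ‖S'‖ = ⨆ j, ‖S j‖ := by
  have hle := rs_norm_le hlam hroot hS hS'
  have hbdd : BddAbove (Set.range fun j => ‖S j‖) := ⟨‖S'‖, by rintro _ ⟨j, rfl⟩; exact hle j⟩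
  have hC : ∀ j, ‖S j‖ ≤ ⨆ j, ‖S j‖ := fun j => le_ciSup hbdd j
  have hC0 : 0 ≤ ⨆ j, ‖S j‖ := (norm_nonneg _).trans (hC (Classical.arbitrary J))
  refine le_antisymm ?_ (ciSup_le hle)
  refine ContinuousLinearMap.opNorm_le_bound _ hC0 fun h => ?_
  refine subnormal_norm_le_of_pow S' hsub hC0 {g | (g : ∀ _, ℂ) none = 0} ?_ 1 h ?_
  · intro g hg
    have hg' : (g : ∀ _, ℂ) none = 0 := hg
    refine norm_le_of_blocks p lam S hS hC0 hC some (Option.some_injective _) g (S' g) ?_ ?_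
    · rintro (_ | w) hw
      · rw [hS']; simp [rsWeights]
      · exact absurd ⟨w, rfl⟩ hw
    · intro j v
      rw [hS']
      by_cases hv : v = ω j
      · subst hv
        simp [rsParent, rsWeights, hlam, hg']
      · simp [rsParent, rsWeights, hv]
  · change ((S' ^ 1) h : ∀ _, ℂ) none = 0
    rw [pow_one, hS']; simp [rsWeights]

lemma ext_pow_zero {V : Type u} {p : V → V} {ω : V} {lam : V → ℂ} {m : ℕ}
    {mu : Fin m → ℂ} {R : Hs (V ⊕ Fin m) →L[ℂ] Hs (V ⊕ Fin m)}
    (hR : IsWeightedShift (extParent p ω m) (extWeights lam ω m mu) R) (h : Hs (V ⊕ Fin m))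
    (n : ℕ) : ∀ i : Fin m, m ≤ i + n → ((R ^ n) h : ∀ _, ℂ) (Sum.inr i) = 0 := by
  induction n with
  | zero => intro i hi; have := i.2; omega
  | succ n ih =>
    intro i hi
    have e : (R ^ (n + 1)) h = R ((R ^ n) h) := by rw [pow_succ']; rfl
    rw [e, hR]
    by_cases hi' : (i : ℕ) + 1 < m
    · have := ih ⟨i + 1, hi'⟩ (by simp; omega)
      have hp : extParent p ω m (Sum.inr i) = Sum.inr ⟨i + 1, hi'⟩ := by simp [extParent, hi']
      rw [hp, this, mul_zero]
    · simp [extWeights, hi']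

lemma ext_norm_le {V : Type u} {p : V → V} {ω : V} {lam : V → ℂ} (hlam : lam ω = 0) {m : ℕ}
    {mu : Fin m → ℂ} {S : Hs V →L[ℂ] Hs V} (hS : IsWeightedShift p lam S) {C : ℝ} (hC0 : 0 ≤ C)
    (hC : ‖S‖ ≤ C) {R : Hs (V ⊕ Fin m) →L[ℂ] Hs (V ⊕ Fin m)}
    (hR : IsWeightedShift (extParent p ω m) (extWeights lam ω m mu) R) (hsub : Subnormal R) :
    ‖R‖ ≤ C := by
  refine ContinuousLinearMap.opNorm_le_bound _ hC0 fun h => ?_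
  refine subnormal_norm_le_of_pow R hsub hC0 {g | ∀ i, (g : ∀ _, ℂ) (Sum.inr i) = 0} ?_ m h ?_
  · intro g hg
    have hg' : ∀ i, (g : ∀ _, ℂ) (Sum.inr i) = 0 := hg
    refine norm_le_of_blocks (J := PUnit) (fun _ => p) (fun _ => lam) (fun _ => S) (fun _ => hS)
      hC0 (fun _ => hC) (fun x => Sum.inl x.2) ?_ g (R g) ?_ ?_
    · rintro ⟨_, v⟩ ⟨_, v'⟩ hv
      simpa using hv
    · rintro (v | i) hw
      · exact absurd ⟨⟨PUnit.unit, v⟩, rfl⟩ hw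
      · rw [hR]
        by_cases hi' : (i : ℕ) + 1 < m
        · simp [extParent, hi', hg']
        · simp [extWeights, hi']
    · intro _ v
      rw [hR]
      by_cases hv : v = ω
      · subst hv
        by_cases hm : 0 < m
        · simp [extParent, hlam, hm, hg']
        · simp [extWeights, hlam, hm]
      · simp [extParent, extWeights, hv]
  · intro i
    exact ext_pow_zero hR h m i (by omega)

/-! ### Construction of the rooted sum -/

lemma ext_step0 {V : Type u} {p : V → V} {ω : V} {lam : V → ℂ} {k : ℕ}
    {mu : Fin k → ℂ} {K : Type u} [NormedAddCommGroup K] [InnerProductSpace ℂ K] {N : K →L[ℂ] K}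
    {b : V ⊕ Fin k → K} (h : Realizes (extParent p ω k) (extWeights lam ω k mu) N b)
    (hk : 0 < k) : N (b (Sum.inr ⟨0, hk⟩)) = mu ⟨0, hk⟩ • b (Sum.inl ω) := by
  have hp : extParent p ω k (Sum.inl ω) = Sum.inr ⟨0, hk⟩ := by simp [extParent, hk]
  have hq : extWeights lam ω k mu (Sum.inl ω) = mu ⟨0, hk⟩ := by simp [extWeights, hk]
  rw [(h.2 _).unique (hasSum_single (Sum.inl ω) ?_), if_pos hp, hq]
  rintro (u | ⟨u, hu⟩) hne
  · have : u ≠ ω := fun h => hne (by rw [h])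
    simp [extParent, this]
  · by_cases h : u + 1 < k
    · simp [extParent, h]
    · simp [extParent, extWeights, h]

lemma ext_step {V : Type u} {p : V → V} {ω : V} {lam : V → ℂ} {k : ℕ}
    {mu : Fin k → ℂ} {K : Type u} [NormedAddCommGroup K] [InnerProductSpace ℂ K] {N : K →L[ℂ] K}
    {b : V ⊕ Fin k → K} (h : Realizes (extParent p ω k) (extWeights lam ω k mu) N b)
    (i : ℕ) (hi : i + 1 < k) : N (b (Sum.inr ⟨i + 1, hi⟩)) =
      mu ⟨i + 1, hi⟩ • b (Sum.inr ⟨i, by omega⟩) := by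
  have hi' : i < k := by omega
  have hp : extParent p ω k (Sum.inr ⟨i, hi'⟩) = Sum.inr ⟨i + 1, hi⟩ := by
    simp [extParent, hi]
  have hq : extWeights lam ω k mu (Sum.inr ⟨i, hi'⟩) = mu ⟨i + 1, hi⟩ := by
    simp [extWeights, hi]
  rw [(h.2 _).unique (hasSum_single (Sum.inr ⟨i, hi'⟩) ?_), if_pos hp, hq]
  rintro (u | ⟨u, hu⟩) hne
  · by_cases h : u = ω
    · simp [extParent, h, show 0 < k by omega]
    · simp [extParent, h]
  · by_cases h : u + 1 < k
    · have : u ≠ i := fun h => hne (by subst h; rfl)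
      simp [extParent, h, this]
    · simp [extParent, extWeights, h]

lemma ext_pow_root {V : Type u} {p : V → V} {ω : V} {lam : V → ℂ} {k : ℕ}
    {mu : Fin k → ℂ} {K : Type u} [NormedAddCommGroup K] [InnerProductSpace ℂ K] {N : K →L[ℂ] K}
    {b : V ⊕ Fin k → K} (h : Realizes (extParent p ω k) (extWeights lam ω k mu) N b)
    (hmu : ∀ i, mu i ≠ 0) (i : ℕ) (hi : i < k) :
    ∃ c : ℂ, c ≠ 0 ∧ (N ^ i) (b (Sum.inr ⟨i, hi⟩)) = c • b (Sum.inr ⟨0, by omega⟩) := by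
  induction i with
  | zero => exact ⟨1, one_ne_zero, by simp⟩
  | succ i ih =>
    obtain ⟨c, hc, e⟩ := ih (by omega)
    refine ⟨mu ⟨i + 1, hi⟩ * c, mul_ne_zero (hmu _) hc, ?_⟩
    rw [pow_succ]
    change (N ^ i) (N _) = _
    rw [ext_step h i hi, map_smul, e, smul_smul]

lemma opL_id_pow {ι : Type*} {G : ι → Type*} [∀ i, NormedAddCommGroup (G i)]
    [∀ i, InnerProductSpace ℂ (G i)] (A : ∀ i, G i →L[ℂ] G i) (C : ℝ)
    (hC : ∀ i, ‖A i‖ ≤ C) (n : ℕ) (x : lp G 2) (i : ι) :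
    ((opL id Function.injective_id A C hC ^ n) x) i = (A i ^ n) (x i) := by
  induction n with
  | zero => simp
  | succ n ih =>
    rw [pow_succ', pow_succ']
    change opL id Function.injective_id A C hC ((opL id Function.injective_id A C hC ^ n) x) i =
      A i ((A i ^ n) (x i))
    rw [opL_apply, ← ih]
    rfl

lemma opL_sgL {ι : Type*} {G : ι → Type*} [∀ i, NormedAddCommGroup (G i)]
    [∀ i, InnerProductSpace ℂ (G i)] (A : ∀ i, G i →L[ℂ] G i) (C : ℝ)
    (hC : ∀ i, ‖A i‖ ≤ C) (i : ι) (x : G i) :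
    opL id Function.injective_id A C hC (sgL i x) = sgL i (A i x) := by
  ext l
  rw [opL_apply, sgL_eq, sgL_eq, lp.single_apply, lp.single_apply]
  by_cases h : l = i
  · subst h; simp
  · change A l ((Pi.single i x : ∀ i, G i) l) = _
    rw [Pi.single_eq_of_ne h, Pi.single_eq_of_ne h, map_zero]

lemma rs_construct {J : Type u} [Countable J] [Nonempty J] {V : J → Type u}
    {p : ∀ j, V j → V j} {ω : ∀ j, V j} {lam : ∀ j, V j → ℂ} (hlam : ∀ j, lam j (ω j) = 0)
    (d : ∀ j, V j → ℕ) (hd : ∀ j v, v ≠ ω j → d j v = d j (p j v) + 1)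
    (hd0 : ∀ j, d j (ω j) = 0) (k : ℕ)
    {K : J → Type u} [∀ j, NormedAddCommGroup (K j)] [∀ j, InnerProductSpace ℂ (K j)]
    [∀ j, CompleteSpace (K j)] (N : ∀ j, K j →L[ℂ] K j) (hN : ∀ j, IsStarNormal (N j))
    (C : ℝ) (hC : ∀ j, ‖N j‖ ≤ C) (mu : ∀ _ : J, Fin (k + 1) → ℂ) (hmu : ∀ j i, mu j i ≠ 0)
    (b : ∀ j, V j ⊕ Fin (k + 1) → K j)
    (hb : ∀ j, Realizes (extParent (p j) (ω j) (k + 1))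
      (extWeights (lam j) (ω j) (k + 1) (mu j)) (N j) (b j)) :
    ∃ θ : J → ℂ, (∀ j, θ j ≠ 0) ∧
        ∃ S' : Hs (Option (Σ j, V j)) →L[ℂ] Hs (Option (Σ j, V j)),
          IsWeightedShift (rsParent p ω) (rsWeights lam ω θ) S' ∧
          AdmitsSubnormalBackExt (rsParent p ω) (rsWeights lam ω θ) none S' k := by
  have hpow := fun j => ext_pow_root (hb j) (hmu j) k (Nat.lt_succ_self k)
  choose c hc0 hc using hpow
  obtain ⟨ε, hε, c', hεs, -⟩ := NNReal.exists_pos_sum_of_countable (ε := 1) one_ne_zero J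
  let a : J → ℂ := fun j => (Real.sqrt (ε j) : ℂ)
  have ha : ∀ j, ‖a j‖ ^ 2 = ε j := by
    intro j
    simp only [a, Complex.norm_real, Real.norm_eq_abs, sq_abs]
    exact Real.sq_sqrt (ε j).2
  have ha0 : ∀ j, a j ≠ 0 := by
    intro j h0
    have := ha j
    rw [h0, norm_zero] at this
    have h1 := hε j
    have h2 : (0 : ℝ) < ε j := by exact_mod_cast h1
    simp at this
    linarith
  have hxs : Summable (fun j => ‖a j • b j (Sum.inr ⟨k, Nat.lt_succ_self k⟩)‖ ^ 2) := by
    have : (fun j => ‖a j • b j (Sum.inr ⟨k, Nat.lt_succ_self k⟩)‖ ^ 2) = fun j => (ε j : ℝ) := by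
      funext j
      rw [norm_smul, (hb j).1.1, mul_one, ha]
    rw [this]
    exact NNReal.summable_coe.2 hεs.summable
  let x : lp K 2 := ⟨fun j => a j • b j (Sum.inr ⟨k, Nat.lt_succ_self k⟩), memlp_two hxs⟩
  let D : lp K 2 →L[ℂ] lp K 2 := opL id Function.injective_id N C hC
  have hD : IsStarNormal D := diag_normal N C hC hN
  have hDsg : ∀ j y, D (sgL j y) = sgL j (N j y) := opL_sgL N C hC
  have hDap : ∀ (f : lp K 2) j, D f j = N j (f j) := fun f j => opL_apply _ _ _ _ _ f j
  let Y : lp K 2 := (D ^ k) x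
  have hY : ∀ j, Y j = (a j * c j) • b j (Sum.inr ⟨0, Nat.succ_pos k⟩) := by
    intro j
    change ((opL id Function.injective_id N C hC ^ k) x) j = _
    rw [opL_id_pow]
    change (N j ^ k) (a j • b j (Sum.inr ⟨k, Nat.lt_succ_self k⟩)) = _
    rw [map_smul, hc, smul_smul]
  have hYx : (D ^ k) x = Y := rfl
  clear_value D Y
  have hYne : Y ≠ 0 := by
    intro h0
    obtain ⟨j⟩ := ‹Nonempty J›
    have := hY j
    rw [h0] at this
    exact smul_ne_zero (mul_ne_zero (ha0 j) (hc0 j)) ((hb j).1.ne_zero _) this.symm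
  let ν : ℂ := (‖Y‖ : ℂ)
  have hν : ν ≠ 0 := by simpa [ν] using hYne
  let θ : J → ℂ := fun j => ν⁻¹ * (a j * c j) * mu j ⟨0, Nat.succ_pos k⟩
  have hθ : ∀ j, θ j ≠ 0 := fun j =>
    mul_ne_zero (mul_ne_zero (inv_ne_zero hν) (mul_ne_zero (ha0 j) (hc0 j))) (hmu _ _)
  let B : Option (Σ j, V j) → lp K 2 := fun w => match w with
    | none => ν⁻¹ • Y
    | some ⟨j, v⟩ => sgL j (b j (Sum.inl v))
  have hYsg : ∀ j (v : V j), inner ℂ (ν⁻¹ • Y) (sgL j (b j (Sum.inl v))) = 0 := by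
    intro j v
    rw [inner_smul_left, sgL_eq, lp.inner_single_right, hY, inner_smul_left,
      (hb j).1.2 (by simp)]
    simp
  have hBon : Orthonormal ℂ B := by
    constructor
    · rintro (_ | ⟨j, v⟩)
      · change ‖ν⁻¹ • Y‖ = 1
        rw [norm_smul, norm_inv]
        have := norm_ne_zero_iff.2 hYne
        simp [ν, this]
      · change ‖sgL j (b j (Sum.inl v))‖ = 1
        rw [LinearIsometry.norm_map]
        exact (hb j).1.1 _
    · rintro (_ | ⟨j, v⟩) (_ | ⟨j', v'⟩) hne
      · exact absurd rfl hne
      · exact hYsg j' v'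
      · change inner ℂ (sgL j (b j (Sum.inl v))) (ν⁻¹ • Y) = 0
        rw [← inner_conj_symm, hYsg, map_zero]
      · change inner ℂ (sgL j (b j (Sum.inl v))) (sgL j' (b j' (Sum.inl v'))) = 0
        by_cases hj : j = j'
        · subst hj
          rw [inner_sgL_self]
          refine (hb j).1.2 fun h => hne ?_
          rw [Sum.inl.inj h]
        · exact inner_sgL_ne _ _ hj _ _
  have hreal : Realizes (rsParent p ω) (rsWeights lam ω θ) D B := by
    refine ⟨hBon, ?_⟩
    rintro (_ | ⟨j, v⟩)
    · change HasSum _ (D (ν⁻¹ • Y))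
      have hinj : Function.Injective (fun j : J => (some ⟨j, ω j⟩ : Option (Σ j, V j))) := by
        intro j j' h
        simp only [Option.some.injEq, Sigma.mk.injEq] at h
        exact h.1
      rw [← hinj.hasSum_iff]
      · have h := lp.hasSum_single (p := 2) (by norm_num) (D (ν⁻¹ • Y))
        convert! h using 2 with j
        rw [hDap]
        change _ = lp.single 2 j (N j (ν⁻¹ • Y j))
        rw [hY, smul_smul, map_smul, ext_step0 (hb j) (Nat.succ_pos k), smul_smul, ← sgL_eq,
          map_smul]
        simp only [Function.comp, rsParent, rsWeights, if_true]
        rfl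
      · rintro (_ | ⟨j, v⟩) hu
        · simp [rsWeights]
        · have : v ≠ ω j := by
            rintro rfl
            exact hu ⟨j, rfl⟩
          simp [rsParent, this]
    · change HasSum _ (D (sgL j (b j (Sum.inl v))))
      rw [hDsg]
      have hinj : Function.Injective (fun u : V j => (some ⟨j, u⟩ : Option (Σ j, V j))) := by
        intro u u' h
        simpa using h
      rw [← hinj.hasSum_iff]
      · have h := ((ext_restrict (hlam j) (hb j)).2 v).mapL (sgL j).toContinuousLinearMap
        convert! h using 2 with u
        by_cases hu : u = ω j
        · subst hu
          simp [rsParent, hlam]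
        · simp only [Function.comp, rsParent, rsWeights, hu, if_false, Option.some.injEq,
            Sigma.mk.injEq, true_and, heq_eq_eq, LinearIsometry.coe_toContinuousLinearMap]
          split_ifs
          · rw [map_smul]
          · rw [map_zero]
      · rintro (_ | ⟨j', u⟩) hu
        · simp [rsWeights]
        · have hne : j' ≠ j := by
            rintro rfl
            exact hu ⟨u, rfl⟩
          by_cases hu' : u = ω j'
          · simp [rsParent, hu']
          · simp [rsParent, hu', hne]
  obtain ⟨S', hS'⟩ := hreal.exists_shift
  refine ⟨θ, hθ, S', hS', hreal.subnormal hD hS', ?_⟩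
  let dd : Option (Σ j, V j) → ℕ := fun w => match w with
    | none => 0
    | some ⟨j, v⟩ => d j v + 1
  refine backExt D hD rfl dd ?_ rfl hreal k x ν hν ?_
  · rintro (_ | ⟨j, v⟩) hv
    · exact absurd rfl hv
    · by_cases h : v = ω j
      · subst h
        simp [dd, rsParent, hd0]
      · simp [dd, rsParent, h, hd j v h]
  · rw [hYx]
    change Y = ν • ν⁻¹ • Y
    rw [smul_smul, mul_inv_cancel₀ hν, one_smul]

lemma rs_of_ext {J : Type u} [Countable J] [Nonempty J] {V : J → Type u}
    {p : ∀ j, V j → V j} {ω : ∀ j, V j} (htree : ∀ j, IsDirectedTree (p j))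
    (hroot : ∀ j, p j (ω j) = ω j)
    {lam : ∀ j, V j → ℂ} (hlam : ∀ j, lam j (ω j) = 0)
    {S : ∀ j, Hs (V j) →L[ℂ] Hs (V j)} (hS : ∀ j, IsWeightedShift (p j) (lam j) (S j)) (k : ℕ)
    (h : ∀ j, AdmitsSubnormalBackExt (p j) (lam j) (ω j) (S j) (k + 1))
    (C : ℝ) (hC : ∀ j, ‖S j‖ ≤ C) :
    ∃ θ : J → ℂ, (∀ j, θ j ≠ 0) ∧
        ∃ S' : Hs (Option (Σ j, V j)) →L[ℂ] Hs (Option (Σ j, V j)),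
          IsWeightedShift (rsParent p ω) (rsWeights lam ω θ) S' ∧
          AdmitsSubnormalBackExt (rsParent p ω) (rsWeights lam ω θ) none S' k := by
  have hC0 : 0 ≤ C := (norm_nonneg _).trans (hC (Classical.arbitrary J))
  choose mu hmu R hR hRs using fun j => (h j).2
  choose d hd hd0 using fun j => depth_exists (htree j) (hroot j)
  choose K i1 i2 i3 Jm N hN hJ hNC using fun j =>
    subnormal_bounded (R j) (hRs j) (ext_norm_le (hlam j) (hS j) hC0 (hC j) (hR j) (hRs j))
  exact rs_construct hlam d hd hd0 k N hN C hNC mu hmu (fun j w => Jm j (ev w))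
    (fun j => (shift_realizes (hR j)).map (Jm j) (hJ j))

/-! ### From the rooted sum to its summands -/

section branch
variable {K : Type u} [NormedAddCommGroup K] [InnerProductSpace ℂ K]

/-- the closed linear span of part of a family of vectors -/
def spanB {W : Type u} (b : W → K) (s : Set W) : Submodule ℂ K :=
  (Submodule.span ℂ (b '' s)).topologicalClosure

lemma spanB_closed {W : Type u} (b : W → K) (s : Set W) : IsClosed (spanB b s : Set K) :=
  Submodule.isClosed_topologicalClosure _

lemma spanB_mem {W : Type u} (b : W → K) (s : Set W) {w : W} (hw : w ∈ s) : b w ∈ spanB b s :=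
  Submodule.le_topologicalClosure _ (Submodule.subset_span ⟨w, hw, rfl⟩)

lemma spanB_hasSum {W : Type u} (b : W → K) (s : Set W) {f : W → K} {y : K} (hf : HasSum f y)
    (h : ∀ w, f w ∈ spanB b s) : y ∈ spanB b s :=
  (spanB_closed b s).mem_of_tendsto hf
    (Filter.Eventually.of_forall fun F => Submodule.sum_mem _ fun w _ => h w)

lemma spanB_map {W : Type u} {q : W → W} {lam : W → ℂ} {N : K →L[ℂ] K} {b : W → K}
    (h : Realizes q lam N b) (s : Set W) (hs : ∀ u, q u ∈ s → u ∈ s) {y : K}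
    (hy : y ∈ spanB b s) : N y ∈ spanB b s := by
  have hle : spanB b s ≤ (spanB b s).comap (N : K →ₗ[ℂ] K) := by
    refine Submodule.topologicalClosure_minimal _ (Submodule.span_le.2 ?_)
      ((spanB_closed b s).preimage N.continuous)
    rintro _ ⟨w, hw, rfl⟩
    refine spanB_hasSum b s (h.2 w) fun u => ?_
    split_ifs with hu
    · exact Submodule.smul_mem _ _ (spanB_mem b s (hs u (by rwa [hu])))
    · exact Submodule.zero_mem _
  exact hle hy

lemma spanB_pow {W : Type u} {q : W → W} {lam : W → ℂ} {N : K →L[ℂ] K} {b : W → K}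
    (h : Realizes q lam N b) (s : Set W) (hs : ∀ u, q u ∈ s → u ∈ s) {y : K}
    (hy : y ∈ spanB b s) (n : ℕ) : (N ^ n) y ∈ spanB b s := by
  induction n with
  | zero => simpa using hy
  | succ n ih =>
    rw [pow_succ']
    exact spanB_map h s hs ih

lemma spanB_orth {W : Type u} {b : W → K} (hb : Orthonormal ℂ b) {s t : Set W}
    (hst : Disjoint s t) {y z : K} (hy : y ∈ spanB b s) (hz : z ∈ spanB b t) :
    inner ℂ y z = 0 := by
  have h1 : Submodule.span ℂ (b '' s) ≤ (Submodule.span ℂ (b '' t))ᗮ := by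
    change Submodule.span ℂ (b '' s) ⟂ Submodule.span ℂ (b '' t)
    rw [Submodule.isOrtho_span]
    rintro _ ⟨u, hu, rfl⟩ _ ⟨v, hv, rfl⟩
    exact hb.2 (fun h => Set.disjoint_left.1 hst hu (h ▸ hv))
  have h2 : spanB b s ≤ (spanB b t)ᗮ := by
    refine Submodule.topologicalClosure_minimal _ ?_ (Submodule.isClosed_orthogonal _)
    rw [spanB, Submodule.orthogonal_closure]
    exact h1
  exact (Submodule.mem_orthogonal' _ _).1 (h2 hy) z hz
end branch

lemma rs_range {J : Type u} {V : J → Type u} {p : ∀ j, V j → V j} {ω : ∀ j, V j}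
    {lam : ∀ j, V j → ℂ} {θ : J → ℂ} (hθ : ∀ j, θ j ≠ 0) {k : ℕ} {mu : Fin k → ℂ}
    (hmu : ∀ i, mu i ≠ 0) {K : Type u} [NormedAddCommGroup K] [InnerProductSpace ℂ K]
    [CompleteSpace K] {N : K →L[ℂ] K} (hN : IsStarNormal N)
    {b : Option (Σ j, V j) ⊕ Fin k → K}
    (hb : Realizes (extParent (rsParent p ω) none k)
      (extWeights (rsWeights lam ω θ) none k mu) N b) (j : J) :
    ∃ (z : K) (β : ℂ), β ≠ 0 ∧ (N ^ (k + 1)) z = β • b (Sum.inl (some ⟨j, ω j⟩)) := by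
  have h' := ext_restrict (lam := rsWeights lam ω θ) rfl hb
  obtain ⟨x, c, hc, hx⟩ : ∃ (x : K) (c : ℂ), c ≠ 0 ∧ (N ^ k) x = c • b (Sum.inl none) := by
    rcases k with _ | k
    · exact ⟨b (Sum.inl none), 1, one_ne_zero, by simp⟩
    · obtain ⟨c, hc, e⟩ := ext_pow_root hb hmu k (Nat.lt_succ_self k)
      refine ⟨b (Sum.inr ⟨k, Nat.lt_succ_self k⟩), c * mu ⟨0, Nat.succ_pos k⟩,
        mul_ne_zero hc (hmu _), ?_⟩
      rw [pow_succ']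
      change N ((N ^ k) _) = _
      rw [e, map_smul, ext_step0 hb (Nat.succ_pos k), smul_smul]
  let b' : Option (Σ j, V j) → K := fun w => b (Sum.inl w)
  have hreal : Realizes (rsParent p ω) (rsWeights lam ω θ) N b' := h'
  let s : Set (Option (Σ j, V j)) := {w | ∃ v, w = some ⟨j, v⟩}
  let t : Set (Option (Σ j, V j)) := {w | ∃ j' v, j' ≠ j ∧ w = some ⟨j', v⟩}
  have hst : Disjoint s t := by
    rw [Set.disjoint_left]
    rintro _ ⟨v, rfl⟩ ⟨j', v', hj', e⟩
    simp only [Option.some.injEq, Sigma.mk.injEq] at e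
    exact hj' e.1.symm
  have hs : ∀ u, rsParent p ω u ∈ s → u ∈ s := by
    rintro (_ | ⟨j', v⟩) ⟨v', hv'⟩
    · simp [rsParent] at hv'
    · by_cases hv : v = ω j'
      · simp [rsParent, hv] at hv'
      · simp only [rsParent, hv, if_false, Option.some.injEq, Sigma.mk.injEq] at hv'
        obtain ⟨rfl, -⟩ := hv'
        exact ⟨v, rfl⟩
  have ht : ∀ u, rsParent p ω u ∈ t → u ∈ t := by
    rintro (_ | ⟨j', v⟩) ⟨j'', v', hj, hv'⟩
    · simp [rsParent] at hv'
    · by_cases hv : v = ω j'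
      · simp [rsParent, hv] at hv'
      · simp only [rsParent, hv, if_false, Option.some.injEq, Sigma.mk.injEq] at hv'
        obtain ⟨rfl, -⟩ := hv'
        exact ⟨j', v, hj, rfl⟩
  let r : K := N (b' none) - θ j • b' (some ⟨j, ω j⟩)
  have hr : r ∈ spanB b' t := by
    have hsum := (hreal.2 none).sub
      (hasSum_ite_eq (some ⟨j, ω j⟩ : Option (Σ j, V j)) (θ j • b' (some ⟨j, ω j⟩)))
    refine spanB_hasSum b' t hsum ?_
    rintro (_ | ⟨j', v⟩)
    · simp [rsWeights]
    · by_cases hv : v = ω j'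
      · subst hv
        by_cases hj : j' = j
        · subst hj
          simp [rsParent, rsWeights]
        · have hm : b' (some ⟨j', ω j'⟩) ∈ spanB b' t := spanB_mem b' t ⟨j', _, hj, rfl⟩
          simp only [rsParent, rsWeights, if_true, Option.some.injEq, Sigma.mk.injEq, hj,
            false_and, if_false, sub_zero]
          exact Submodule.smul_mem _ _ hm
      · have hne : ¬ ((some ⟨j', v⟩ : Option (Σ j, V j)) = some ⟨j, ω j⟩) := by
          intro e
          simp only [Option.some.injEq, Sigma.mk.injEq] at e
          obtain ⟨rfl, e⟩ := e
          exact hv (eq_of_heq e)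
        rw [if_neg hne]
        simp [rsParent, hv]
  have ha : (c * θ j) • b' (some ⟨j, ω j⟩) ∈ spanB b' s :=
    Submodule.smul_mem _ _ (spanB_mem b' s ⟨_, rfl⟩)
  have hNx : (N ^ (k + 1)) x = (c * θ j) • b' (some ⟨j, ω j⟩) + c • r := by
    rw [pow_succ']
    change N ((N ^ k) x) = _
    rw [hx, map_smul, mul_smul, ← smul_add]
    simp only [r]
    rw [add_sub_cancel]
  have hNk : IsStarNormal (N ^ (k + 1)) := by
    refine ⟨?_⟩
    rw [star_pow]
    exact hN.star_comm_self.pow_pow _ _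
  obtain ⟨z, hz⟩ := range_of_orthogonal (N ^ (k + 1)) hNk x _ _ hNx (fun n => by
    rw [← pow_mul]
    exact spanB_orth hreal.1 hst (spanB_pow hreal s hs ha _)
      (spanB_pow hreal t ht (Submodule.smul_mem _ _ hr) _))
  exact ⟨z, c * θ j, mul_ne_zero hc (hθ j), hz⟩

lemma ext_of_rs {J : Type u} {V : J → Type u} {p : ∀ j, V j → V j} {ω : ∀ j, V j}
    (htree : ∀ j, IsDirectedTree (p j)) (hroot : ∀ j, p j (ω j) = ω j)
    {lam : ∀ j, V j → ℂ} (hlam : ∀ j, lam j (ω j) = 0)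
    {S : ∀ j, Hs (V j) →L[ℂ] Hs (V j)} (hS : ∀ j, IsWeightedShift (p j) (lam j) (S j)) (k : ℕ)
    {θ : J → ℂ} (hθ : ∀ j, θ j ≠ 0)
    {S' : Hs (Option (Σ j, V j)) →L[ℂ] Hs (Option (Σ j, V j))}
    (h : AdmitsSubnormalBackExt (rsParent p ω) (rsWeights lam ω θ) none S' k) (j : J) :
    AdmitsSubnormalBackExt (p j) (lam j) (ω j) (S j) (k + 1) := by
  obtain ⟨-, mu, hmu, R, hR, K, i1, i2, i3, Jm, N, hN, hJ⟩ := h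
  have hb := (shift_realizes hR).map Jm hJ
  have hb' := rs_restrict hlam (ext_restrict (lam := rsWeights lam ω θ) rfl hb) j
  obtain ⟨z, β, hβ, hz⟩ := rs_range hθ hmu hN hb j
  obtain ⟨d, hd, hd0⟩ := depth_exists (htree j) (hroot j)
  exact ⟨hb'.subnormal hN (hS j),
    backExt N hN (hlam j) d hd hd0 hb' (k + 1) z β hβ hz⟩

/-- Lemma (rootsum-ext): a nonempty at most countable family of bounded weighted shifts
on rooted directed trees can be joined (with some nonzero weights at the old roots)
into a weighted shift on the rooted sum admitting a subnormal `k`-step backward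
extension iff every member admits a subnormal `(k+1)`-step backward extension and the
family is uniformly bounded; moreover, in that case the norm of the joined shift
equals the supremum of the norms. -/
theorem rootSumSubExt {J : Type u} [Countable J] [Nonempty J] {V : J → Type u}
    (p : ∀ j, V j → V j) (ω : ∀ j, V j)
    (htree : ∀ j, IsDirectedTree (p j)) (hroot : ∀ j, p j (ω j) = ω j)
    (lam : ∀ j, V j → ℂ) (hw : ∀ j, WeightSystem (p j) (lam j))
    (S : ∀ j, Hs (V j) →L[ℂ] Hs (V j))
    (hS : ∀ j, IsWeightedShift (p j) (lam j) (S j)) (k : ℕ) :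
    ((∃ θ : J → ℂ, (∀ j, θ j ≠ 0) ∧
        ∃ S' : Hs (Option (Σ j, V j)) →L[ℂ] Hs (Option (Σ j, V j)),
          IsWeightedShift (rsParent p ω) (rsWeights lam ω θ) S' ∧
          AdmitsSubnormalBackExt (rsParent p ω) (rsWeights lam ω θ) none S' k) ↔
      ((∀ j, AdmitsSubnormalBackExt (p j) (lam j) (ω j) (S j) (k + 1)) ∧
        ∃ C : ℝ, ∀ j, ‖S j‖ ≤ C)) ∧
    (∀ θ : J → ℂ, (∀ j, θ j ≠ 0) →
      ∀ S' : Hs (Option (Σ j, V j)) →L[ℂ] Hs (Option (Σ j, V j)),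
        IsWeightedShift (rsParent p ω) (rsWeights lam ω θ) S' →
        AdmitsSubnormalBackExt (rsParent p ω) (rsWeights lam ω θ) none S' k →
        ‖S'‖ = ⨆ j, ‖S j‖) := by
  have hlam : ∀ j, lam j (ω j) = 0 := fun j => hw j _ (hroot j)
  refine ⟨⟨?_, ?_⟩, ?_⟩
  · rintro ⟨θ, hθ, S', hS', h⟩
    exact ⟨ext_of_rs htree hroot hlam hS k hθ h, ‖S'‖, rs_norm_le hlam hroot hS hS'⟩
  · rintro ⟨h, C, hC⟩
    exact rs_of_ext htree hroot hlam hS k h C hC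
  · intro θ _ S' hS' h
    exact rs_norm hlam hroot hS hS' h.1

end ShiftsPaper
end
end

section
/- Let S_λ be a bounded subnormal weighted shift on a rooted directed tree T=(V,p) with root ω, and let k ≥ 1. Then S_λ admits a subnormal k-step backward extension if and only if there exists a representing measure μ for the Stieltjes moment sequence (‖S_λ^n e_ω‖²)_{n≥0} such that ∫_[0,∞) t^{-k} dμ(t) < ∞. -/
open scoped ENNReal Classical
noncomputable section

universe u

namespace ShiftsPaper

/-- Abstract construction of a subnormal weighted shift from an orthonormal family. -/
lemma exists_shift_of_orthonormal {W : Type u} {H : Type u} [NormedAddCommGroup H]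
    [InnerProductSpace ℂ H] [CompleteSpace H] (N : H →L[ℂ] H) (hN : IsStarNormal N)
    (b : W → H) (hb : Orthonormal ℂ b)
    (hinv : ∀ u, N (b u) ∈ (Submodule.span ℂ (Set.range b)).topologicalClosure)
    (p' : W → W) (lam' : W → ℂ)
    (hmat : ∀ w u, inner ℂ (b w) (N (b u)) = if p' w = u then lam' w else 0) :
    ∃ S' : Hs W →L[ℂ] Hs W, IsWeightedShift p' lam' S' ∧ Subnormal S' := by
  let J : Hs W →ₗᵢ[ℂ] H := hb.orthogonalFamily.linearIsometry
  have hJ : ∀ w (a : ℂ), J (lp.single 2 w a) = a • b w := by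
    intro w a
    simp [J]
  let Jc : Hs W →L[ℂ] H := J.toContinuousLinearMap
  have hJJ : ∀ x, ContinuousLinearMap.adjoint Jc (J x) = x := by
    intro x
    refine ext_inner_left ℂ fun y => ?_
    rw [ContinuousLinearMap.adjoint_inner_right]
    exact J.inner_map_map y x
  have hcl : IsClosed (Set.range J) := J.isometry.isClosedEmbedding.isClosed_range
  have hspan : (Submodule.span ℂ (Set.range b)).topologicalClosure ≤ LinearMap.range J.toLinearMap := by
    apply Submodule.topologicalClosure_minimal
    · rw [Submodule.span_le]
      rintro _ ⟨w, rfl⟩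
      exact ⟨lp.single 2 w 1, by simpa using hJ w 1⟩
    · exact hcl
  have hrange : ∀ f, N (J f) ∈ Set.range J := by
    intro f
    have h1 : HasSum (fun i => lp.single 2 i (f i)) f := lp.hasSum_single (by simp) f
    have h2 := h1.mapL (N ∘L Jc)
    refine hcl.mem_of_tendsto h2 (Filter.Eventually.of_forall fun s => ?_)
    have : (∑ i ∈ s, (N ∘L Jc) (lp.single 2 i (f i))) ∈ LinearMap.range J.toLinearMap := by
      refine Submodule.sum_mem _ fun i _ => ?_
      have : (N ∘L Jc) (lp.single 2 i (f i)) = (f i) • N (b i) := by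
        show N (J _) = _
        rw [hJ, map_smul]
      rw [this]
      exact Submodule.smul_mem _ _ (hspan (hinv i))
    simpa using this
  let S' : Hs W →L[ℂ] Hs W := ContinuousLinearMap.adjoint Jc ∘L N ∘L Jc
  refine ⟨S', ?_, H, inferInstance, inferInstance, inferInstance, J, N, hN, ?_⟩
  · intro f w
    have h1 : HasSum (fun i => lp.single 2 i (f i)) f := lp.hasSum_single (by simp) f
    have h2 := h1.mapL ((innerSL ℂ (b w)) ∘L (N ∘L Jc))
    have h3 : ∀ g, (S' g : ∀ _ : W, ℂ) w = ((innerSL ℂ (b w)) ∘L (N ∘L Jc)) g := by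
      intro g
      have e1 := lp.inner_single_left (𝕜 := ℂ) (G := fun _ : W => ℂ) w (1:ℂ) (S' g)
      have e2 : inner ℂ (lp.single 2 w (1:ℂ) : Hs W) (S' g) = inner ℂ (b w) (N (J g)) := by
        show inner ℂ _ (ContinuousLinearMap.adjoint Jc (N (J g))) = _
        rw [ContinuousLinearMap.adjoint_inner_right]
        show inner ℂ (J _) _ = _
        rw [hJ, one_smul]
      rw [e2] at e1
      have e3 : (S' g : ∀ _ : W, ℂ) w = inner ℂ (b w) (N (J g)) := by simpa using e1.symm
      exact e3
    rw [h3]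
    have h4 : ∀ i, ((innerSL ℂ (b w)) ∘L (N ∘L Jc)) (lp.single 2 i (f i))
        = if i = p' w then lam' w * f (p' w) else 0 := by
      intro i
      have : ((innerSL ℂ (b w)) ∘L (N ∘L Jc)) (lp.single 2 i (f i))
        = inner ℂ (b w) (N (J (lp.single 2 i (f i)))) := rfl
      rw [this, hJ, map_smul, inner_smul_right, hmat]
      by_cases h : p' w = i
      · subst h; simp [mul_comm]
      · simp [h, Ne.symm h]
    have h5 : HasSum (fun i => ((innerSL ℂ (b w)) ∘L (N ∘L Jc)) (lp.single 2 i (f i)))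
        (lam' w * f (p' w)) := by
      simp_rw [h4]
      exact hasSum_ite_eq (p' w) _
    exact h2.unique h5
  · intro x
    obtain ⟨g, hg⟩ := hrange x
    show N (J x) = J (ContinuousLinearMap.adjoint Jc (N (J x)))
    rw [← hg, hJJ]

/-- The operator `(f ↦ (n ↦ N (f (e n))))` on `ℓ²(ℤ, K)`. -/
lemma exists_lift {K : Type u} [NormedAddCommGroup K] [InnerProductSpace ℂ K]
    (e : ℤ ≃ ℤ) (N : K →L[ℂ] K) :
    ∃ D : lp (fun _ : ℤ => K) 2 →L[ℂ] lp (fun _ : ℤ => K) 2, ∀ f n, D f n = N (f (e n)) := by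
  have hs : ∀ f : lp (fun _ : ℤ => K) 2, HasSum (fun n => ‖f (e n)‖ ^ 2) (‖f‖ ^ 2) := by
    intro f
    have := lp.hasSum_norm (by simp) f
    have h2 : HasSum (fun n => ‖f n‖ ^ 2) (‖f‖ ^ 2) := by simpa using this
    exact e.hasSum_iff.mpr h2
  have hle : ∀ (f : lp (fun _ : ℤ => K) 2) n, ‖N (f (e n))‖ ^ 2 ≤ ‖N‖ ^ 2 * ‖f (e n)‖ ^ 2 := by
    intro f n
    rw [← mul_pow]
    gcongr
    exact N.le_opNorm _
  have hsum : ∀ f : lp (fun _ : ℤ => K) 2, Summable (fun n => ‖N (f (e n))‖ ^ 2) := fun f =>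
    Summable.of_nonneg_of_le (fun n => by positivity) (hle f) ((hs f).summable.mul_left _)
  have hmem : ∀ f : lp (fun _ : ℤ => K) 2, Memℓp (fun n => N (f (e n))) 2 := by
    intro f
    apply memℓp_gen
    simpa using hsum f
  refine ⟨LinearMap.mkContinuous
    { toFun := fun f => ⟨fun n => N (f (e n)), hmem f⟩
      map_add' := fun f g => by ext n; simp; rfl
      map_smul' := fun c f => by ext n; simp } ‖N‖ ?_, fun f n => rfl⟩
  intro f
  refine lp.norm_le_of_tsum_le (by simp) (by positivity) ?_
  simp only [ENNReal.toReal_ofNat, Real.rpow_ofNat]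
  rw [mul_pow]
  have h1 := ((hs f).mul_left (‖N‖ ^ 2))
  rw [← h1.tsum_eq]
  exact Summable.tsum_le_tsum (hle f) (hsum f) h1.summable

/-- The graded lift of a normal operator is normal. -/
lemma exists_graded_normal {K : Type u} [NormedAddCommGroup K] [InnerProductSpace ℂ K]
    [CompleteSpace K] (N : K →L[ℂ] K) (hN : IsStarNormal N) :
    ∃ D : lp (fun _ : ℤ => K) 2 →L[ℂ] lp (fun _ : ℤ => K) 2, IsStarNormal D ∧
      ∀ f n, D f n = N (f (n - 1)) := by
  obtain ⟨D, hD⟩ := exists_lift (Equiv.subRight (1 : ℤ)) N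
  obtain ⟨D', hD'⟩ := exists_lift (Equiv.addRight (1 : ℤ)) (ContinuousLinearMap.adjoint N)
  have hadj : ContinuousLinearMap.adjoint D = D' := by
    symm
    rw [ContinuousLinearMap.eq_adjoint_iff]
    intro f g
    rw [lp.inner_eq_tsum, lp.inner_eq_tsum]
    rw [← (Equiv.subRight (1 : ℤ)).tsum_eq]
    refine tsum_congr fun n => ?_
    rw [hD, hD', ContinuousLinearMap.adjoint_inner_left]
    simp
  refine ⟨D, ⟨?_⟩, fun f n => by rw [hD]; rfl⟩
  have hc : ∀ x, ContinuousLinearMap.adjoint N (N x) = N (ContinuousLinearMap.adjoint N x) := by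
    intro x
    have := hN.star_comm_self
    exact congrArg (fun T : K →L[ℂ] K => T x) this.eq
  rw [ContinuousLinearMap.star_eq_adjoint, hadj]
  ext f n
  show D' (D f) n = D (D' f) n
  rw [hD, hD', hD, hD']
  simp [hc]

open MeasureTheory Polynomial in
lemma poly_approx (μ : Measure ℝ) [IsFiniteMeasure μ] (R : ℝ)
    (hR : ∀ᵐ x ∂μ, x ∈ Set.Icc 0 R) (k : ℕ)
    (hk : ∫⁻ x : ℝ, (ENNReal.ofReal (x ^ k))⁻¹ ∂μ < ⊤) (η : ℝ) (hη : 0 < η) :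
    ∃ q : ℝ[X], ∫⁻ x, ENNReal.ofReal (x ^ k * (q.eval x - (x ^ k)⁻¹) ^ 2) ∂μ
      ≤ ENNReal.ofReal (η ^ 2) := by
  have hmeas : Measurable (fun x : ℝ => ENNReal.ofReal (x ^ k)) := by fun_prop
  set ρ := μ.withDensity (fun x : ℝ => ENNReal.ofReal (x ^ k)) with hρ
  have hfin : IsFiniteMeasure ρ := by
    apply isFiniteMeasure_withDensity
    apply ne_of_lt
    calc ∫⁻ x, ENNReal.ofReal (x ^ k) ∂μ ≤ ∫⁻ x, ENNReal.ofReal (R ^ k) ∂μ := by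
          apply lintegral_mono_ae
          filter_upwards [hR] with x hx
          apply ENNReal.ofReal_le_ofReal
          exact pow_le_pow_left₀ hx.1 hx.2 k
      _ < ⊤ := by
          rw [lintegral_const]
          exact ENNReal.mul_lt_top ENNReal.ofReal_lt_top (measure_lt_top _ _)
  have hρR : ∀ᵐ x ∂ρ, x ∈ Set.Icc 0 R := (withDensity_absolutelyContinuous μ _).ae_le hR
  set h : ℝ → ℝ := fun x => (x ^ k)⁻¹ with hh
  have hhm : Measurable h := by fun_prop
  have hsq : ∀ f : ℝ → ℝ, Measurable f → eLpNorm f 2 ρ ^ 2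
      = ∫⁻ x, ENNReal.ofReal (x ^ k) * ENNReal.ofReal (f x ^ 2) ∂μ := by
    intro f hf
    have e1 : eLpNorm f 2 ρ ^ 2 = ∫⁻ x, ‖f x‖ₑ ^ (2:ℝ) ∂ρ := by
      have := eLpNorm_nnreal_pow_eq_lintegral (μ := ρ) (f := f) (p := 2) (by simp)
      simpa using this
    rw [e1, hρ, lintegral_withDensity_eq_lintegral_mul _ hmeas (by fun_prop)]
    refine lintegral_congr fun x => ?_
    simp only [Pi.mul_apply]
    congr 1
    rw [← ofReal_norm, ENNReal.ofReal_rpow_of_nonneg (by positivity) (by positivity)]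
    simp
  have hmem : MemLp h 2 ρ := by
    refine ⟨hhm.aestronglyMeasurable, ?_⟩
    have : eLpNorm h 2 ρ ^ 2 < ⊤ := by
      rw [hsq h hhm]
      refine lt_of_le_of_lt (lintegral_mono fun x => ?_) hk
      by_cases hx : 0 < x ^ k
      · rw [← ENNReal.ofReal_mul hx.le, ← ENNReal.ofReal_inv_of_pos hx]
        apply ENNReal.ofReal_le_ofReal
        simp only [hh]
        apply le_of_eq
        field_simp
      · simp [ENNReal.ofReal_of_nonpos (not_lt.mp hx)]
    by_contra hc
    rw [not_lt, top_le_iff] at hc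
    simp [hc] at this
  set c : ℝ := ((ρ Set.univ) ^ ((2:ℝ)⁻¹)).toReal with hc
  have hc0 : 0 ≤ c := ENNReal.toReal_nonneg
  have hδ : 0 < η / (1 + c) := by positivity
  set δ := η / (1 + c) with hδd
  obtain ⟨g, hg, -⟩ := hmem.exists_boundedContinuous_eLpNorm_sub_le (by simp)
    (ε := ENNReal.ofReal δ) (by simpa using hδ)
  obtain ⟨q, hq⟩ := exists_polynomial_near_of_continuousOn 0 R g g.continuous.continuousOn δ hδ
  refine ⟨q, ?_⟩
  have h1 : eLpNorm (fun x => q.eval x - g x) 2 ρ ≤ ENNReal.ofReal c * ENNReal.ofReal δ := by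
    have := eLpNorm_le_of_ae_bound (μ := ρ) (p := 2) (f := fun x => q.eval x - g x) (C := δ) (by
      filter_upwards [hρR] with x hx
      exact (hq x hx).le)
    rw [hc, ENNReal.ofReal_toReal]
    · simpa using this
    · apply ENNReal.rpow_ne_top_of_nonneg (by norm_num) (measure_ne_top _ _)
  have h2 : eLpNorm (fun x => q.eval x - h x) 2 ρ ≤ ENNReal.ofReal η := by
    have e : (fun x => q.eval x - h x) = (fun x => q.eval x - g x) - (h - (g : ℝ → ℝ)) := by
      ext x; simp
    have hm1 : Measurable fun x => q.eval x - g x := by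
      have := q.continuous
      have := g.continuous
      fun_prop
    have hm2 : Measurable (h - (g : ℝ → ℝ)) := hhm.sub g.continuous.measurable
    rw [e]
    refine (eLpNorm_sub_le hm1.aestronglyMeasurable hm2.aestronglyMeasurable (by simp)).trans ?_
    refine (add_le_add h1 hg).trans ?_
    rw [← ENNReal.ofReal_mul hc0, ← ENNReal.ofReal_add (by positivity) hδ.le]
    apply ENNReal.ofReal_le_ofReal
    rw [hδd]
    apply le_of_eq
    field_simp
    ring
  have hm3 : Measurable fun x => q.eval x - h x := q.continuous.measurable.sub hhm
  have h3 := hsq _ hm3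
  calc ∫⁻ x, ENNReal.ofReal (x ^ k * (q.eval x - (x ^ k)⁻¹) ^ 2) ∂μ
      = eLpNorm (fun x => q.eval x - h x) 2 ρ ^ 2 := by
        rw [h3]
        apply lintegral_congr_ae
        filter_upwards [hR] with x hx
        rw [ENNReal.ofReal_mul (pow_nonneg hx.1 k)]
    _ ≤ ENNReal.ofReal η ^ 2 := by gcongr
    _ = ENNReal.ofReal (η ^ 2) := by rw [ENNReal.ofReal_pow hη.le]

open MeasureTheory in
lemma ae_bounded_of_moments (μ : Measure ℝ) (h0 : μ (Set.Iio 0) = 0) (C R : ℝ) (hR : 0 ≤ R)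
    (hm : ∀ n : ℕ, ∫⁻ x : ℝ, ENNReal.ofReal (x ^ n) ∂μ ≤ ENNReal.ofReal (C * R ^ n)) :
    ∀ᵐ x ∂μ, x ∈ Set.Icc 0 R := by
  have h1 : ∀ᵐ x ∂μ, 0 ≤ x := by
    rw [ae_iff]
    simpa [Set.Iio] using h0
  have h2 : ∀ m : ℕ, μ (Set.Ici (R + 1 / ((m : ℝ) + 1))) = 0 := by
    intro m
    set R' := R + 1 / ((m : ℝ) + 1) with hR'
    have hlt : R < R' := by
      rw [hR']; have : (0:ℝ) < 1 / ((m : ℝ) + 1) := by positivity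
      linarith
    have hpos : 0 < R' := lt_of_le_of_lt hR hlt
    have hb : ∀ n : ℕ, μ (Set.Ici R') ≤ ENNReal.ofReal (C * (R / R') ^ n) := by
      intro n
      have e1 : ENNReal.ofReal (R' ^ n) * μ (Set.Ici R') ≤ ENNReal.ofReal (C * R ^ n) := by
        refine le_trans ?_ (hm n)
        refine le_trans ?_ (mul_meas_ge_le_lintegral (μ := μ)
          (f := fun x : ℝ => ENNReal.ofReal (x ^ n)) (by fun_prop) (ENNReal.ofReal (R' ^ n)))
        gcongr
        intro x hx
        exact ENNReal.ofReal_le_ofReal (pow_le_pow_left₀ hpos.le hx n)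
      have hp : 0 < R' ^ n := by positivity
      rw [mul_comm, ← ENNReal.le_div_iff_mul_le (by left; simpa using hp) (by left; simp),
        ← ENNReal.ofReal_div_of_pos hp] at e1
      rwa [div_pow, ← mul_div_assoc]
    have ht : Filter.Tendsto (fun n : ℕ => ENNReal.ofReal (C * (R / R') ^ n)) Filter.atTop
        (nhds 0) := by
      have : Filter.Tendsto (fun n : ℕ => C * (R / R') ^ n) Filter.atTop (nhds (C * 0)) :=
        (tendsto_pow_atTop_nhds_zero_of_lt_one (by positivity)
          ((div_lt_one hpos).mpr hlt)).const_mul C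
      simpa using ENNReal.tendsto_ofReal this
    exact le_antisymm (ge_of_tendsto' ht hb) zero_le
  have h3 : ∀ᵐ x ∂μ, ∀ m : ℕ, x < R + 1 / ((m : ℝ) + 1) := by
    rw [ae_all_iff]
    intro m
    rw [ae_iff]
    convert h2 m using 2
    ext x; simp
  filter_upwards [h1, h3] with x hx hx2
  refine ⟨hx, le_of_forall_pos_lt_add fun ε hε => ?_⟩
  obtain ⟨m, hm⟩ := exists_nat_one_div_lt hε
  linarith [hx2 m]

open MeasureTheory in
lemma exists_measure_of_normal {K : Type u} [NormedAddCommGroup K] [InnerProductSpace ℂ K]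
    [CompleteSpace K] (N : K →L[ℂ] K) (hN : IsStarNormal N) (x : K) :
    ∃ μ : Measure ℝ, μ Set.univ < ⊤ ∧
      IsRepresentingMeasure μ (fun n => ‖(N ^ n) x‖ ^ 2) := by
  set A : K →L[ℂ] K := star N * N with hA
  have hA0 : 0 ≤ A := star_mul_self_nonneg N
  have hAsa : IsSelfAdjoint A := IsSelfAdjoint.star_mul_self N
  have hpow : ∀ n : ℕ, RCLike.re (inner ℂ ((A ^ n) x) x) = ‖(N ^ n) x‖ ^ 2 := by
    intro n
    have hc : Commute (star N) N := hN.star_comm_self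
    rw [hA, hc.mul_pow, ← star_pow, mul_apply_eq_comp,
      ContinuousLinearMap.star_eq_adjoint, ContinuousLinearMap.adjoint_inner_left,
      inner_self_eq_norm_sq]
  let X := spectrum ℝ A
  have hX : CompactSpace X := isCompact_iff_compactSpace.mp
    (ContinuousFunctionalCalculus.isCompact_spectrum A)
  let L : CompactlySupportedContinuousMap X ℝ →ₗ[ℝ] ℝ :=
    { toFun := fun f => RCLike.re (inner ℂ (cfcHom hAsa (f : C(X, ℝ)) x) x)
      map_add' := fun f g => by
        have : ((f + g : CompactlySupportedContinuousMap X ℝ) : C(X, ℝ)) = (f : C(X, ℝ)) + g := rfl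
        rw [this, map_add, add_apply, inner_add_left, map_add]
      map_smul' := fun c f => by
        have : ((c • f : CompactlySupportedContinuousMap X ℝ) : C(X, ℝ)) = c • (f : C(X, ℝ)) := rfl
        rw [this, map_smul]
        have e : (c • cfcHom hAsa (f : C(X, ℝ))) x = (c : ℂ) • (cfcHom hAsa (f : C(X, ℝ)) x) := rfl
        rw [e, inner_smul_left]
        simp }
  let Lp : CompactlySupportedContinuousMap X ℝ →ₚ[ℝ] ℝ := PositiveLinearMap.mk₀ L (by
    intro f hf
    have h1 : 0 ≤ cfcHom hAsa (f : C(X, ℝ)) := by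
      rw [cfcHom_nonneg_iff]
      exact hf
    rw [ContinuousLinearMap.nonneg_iff_isPositive] at h1
    exact h1.re_inner_nonneg_left x)
  let ν := RealRMK.rieszMeasure Lp
  have hν : IsFiniteMeasure ν := inferInstance
  have hnn : ∀ y : X, 0 ≤ (y : ℝ) := fun y => spectrum_nonneg_of_nonneg hA0 y.2
  refine ⟨ν.map Subtype.val, measure_lt_top _ _, ?_, ?_⟩
  · rw [Measure.map_apply measurable_subtype_coe measurableSet_Iio]
    convert measure_empty (μ := ν)
    ext y
    simpa using hnn y
  · intro n
    rw [lintegral_map (by fun_prop) measurable_subtype_coe]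
    let f : C(X, ℝ) := (ContinuousMap.restrict X (ContinuousMap.id ℝ)) ^ n
    have hf : ∀ y : X, f y = (y : ℝ) ^ n := fun y => rfl
    let fc : CompactlySupportedContinuousMap X ℝ := CompactlySupportedContinuousMap.continuousMapEquiv f
    have h1 : ∫ y, fc y ∂ν = Lp fc := RealRMK.integral_rieszMeasure Lp fc
    have h2 : Lp fc = ‖(N ^ n) x‖ ^ 2 := by
      rw [← hpow]
      show RCLike.re (inner ℂ (cfcHom hAsa f x) x) = _
      simp only [f]
      rw [map_pow, cfcHom_id]
    have h3 : Integrable (fun y : X => (y : ℝ) ^ n) ν :=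
      (Continuous.integrable_of_hasCompactSupport (by fun_prop) (HasCompactSupport.of_compactSpace _))
    rw [← ofReal_integral_eq_lintegral_ofReal h3
      (Filter.Eventually.of_forall fun y => pow_nonneg (hnn y) n), show ∫ y : X, (y : ℝ) ^ n ∂ν = ‖(N ^ n) x‖ ^ 2 from h1.trans h2]

open Polynomial in
lemma isSelfAdjoint_aeval_real {K : Type u} [NormedAddCommGroup K] [InnerProductSpace ℂ K]
    [CompleteSpace K] (A : K →L[ℂ] K) (hA : IsSelfAdjoint A) (q : ℝ[X]) :
    IsSelfAdjoint (aeval A q) := by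
  induction q using Polynomial.induction_on' with
  | add p q hp hq => rw [map_add]; exact hp.add hq
  | monomial n a =>
    rw [aeval_monomial, ← Algebra.smul_def]
    exact (IsSelfAdjoint.all a).smul (hA.pow n)

open MeasureTheory Polynomial in
lemma inner_aeval_eq {K : Type u} [NormedAddCommGroup K] [InnerProductSpace ℂ K]
    [CompleteSpace K] (A : K →L[ℂ] K) (x : K) (μ : Measure ℝ)
    (hm : ∀ n : ℕ, Integrable (fun t : ℝ => t ^ n) μ ∧
      RCLike.re (inner ℂ ((A ^ n) x) x) = ∫ t, t ^ n ∂μ) (q : ℝ[X]) :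
    Integrable (fun t => q.eval t) μ ∧
      RCLike.re (inner ℂ (aeval A q x) x) = ∫ t, q.eval t ∂μ := by
  induction q using Polynomial.induction_on' with
  | add p q hp hq =>
    simp only [eval_add, map_add, add_apply, inner_add_left]
    exact ⟨hp.1.add hq.1, by rw [hp.2, hq.2, integral_add hp.1 hq.1]⟩
  | monomial n a =>
    simp only [eval_monomial]
    refine ⟨(hm n).1.const_mul a, ?_⟩
    rw [aeval_monomial, ← Algebra.smul_def, integral_const_mul, ← (hm n).2]
    have e : (a • A ^ n) x = (a : ℂ) • ((A ^ n) x) := rfl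
    rw [e, inner_smul_left]
    simp

open MeasureTheory Polynomial in
lemma mem_range_of_measure {K : Type u} [NormedAddCommGroup K] [InnerProductSpace ℂ K]
    [CompleteSpace K] (N : K →L[ℂ] K) (hN : IsStarNormal N) (x : K) (μ : Measure ℝ)
    (hμ : IsRepresentingMeasure μ (fun n => ‖(N ^ n) x‖ ^ 2)) (k : ℕ) (hk1 : 1 ≤ k)
    (hk : ∫⁻ t : ℝ, (ENNReal.ofReal (t ^ k))⁻¹ ∂μ < ⊤) :
    ∃ y, (N ^ k) y = x := by
  obtain ⟨h0, hmom⟩ := hμ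
  simp only at hmom
  have hfin : IsFiniteMeasure μ := by
    refine ⟨?_⟩
    have := hmom 0
    simp only [pow_zero, ENNReal.ofReal_one, lintegral_one] at this
    rw [← this]
    exact ENNReal.ofReal_lt_top
  set R := ‖N‖ ^ 2 with hRd
  have hR0 : 0 ≤ R := by positivity
  have hR : ∀ᵐ t ∂μ, t ∈ Set.Icc 0 R := by
    refine ae_bounded_of_moments μ h0 (‖x‖ ^ 2) R hR0 fun n => ?_
    rw [← hmom n]
    apply ENNReal.ofReal_le_ofReal
    rw [hRd, ← pow_mul, mul_comm 2 n, pow_mul, ← mul_pow, mul_comm]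
    gcongr
    rcases Nat.eq_zero_or_pos n with rfl | hn
    · simp
    refine ((N ^ n).le_opNorm x).trans ?_
    gcongr
    exact norm_pow_le' N hn
  have hne : ∀ᵐ t ∂μ, t ≠ 0 := by
    have := ae_lt_top (by fun_prop) hk.ne
    filter_upwards [this] with t ht h
    subst h
    simp [show k ≠ 0 by omega] at ht
  set A : K →L[ℂ] K := star N * N with hA
  have hAsa : IsSelfAdjoint A := IsSelfAdjoint.star_mul_self N
  have hc : Commute (star N) N := hN.star_comm_self
  have hApow : ∀ n : ℕ, A ^ n = star (N ^ n) * N ^ n := fun n => by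
    rw [hA, hc.mul_pow, star_pow]
  have hApow' : ∀ n : ℕ, A ^ n = N ^ n * star (N ^ n) := fun n => by
    rw [hA, hc.eq, hc.symm.mul_pow, star_pow]
  have hpow : ∀ n : ℕ, RCLike.re (inner ℂ ((A ^ n) x) x) = ‖(N ^ n) x‖ ^ 2 := by
    intro n
    rw [hApow, mul_apply_eq_comp,
      ContinuousLinearMap.star_eq_adjoint, ContinuousLinearMap.adjoint_inner_left,
      inner_self_eq_norm_sq]
  have hm : ∀ n : ℕ, Integrable (fun t : ℝ => t ^ n) μ ∧
      RCLike.re (inner ℂ ((A ^ n) x) x) = ∫ t, t ^ n ∂μ := by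
    intro n
    have hnn : 0 ≤ᵐ[μ] fun t : ℝ => t ^ n := by
      filter_upwards [hR] with t ht using pow_nonneg ht.1 n
    have hmeas : AEStronglyMeasurable (fun t : ℝ => t ^ n) μ :=
      (by fun_prop : Measurable fun t : ℝ => t ^ n).aestronglyMeasurable
    refine ⟨⟨hmeas, ?_⟩, ?_⟩
    · rw [hasFiniteIntegral_iff_ofReal hnn, ← hmom]
      exact ENNReal.ofReal_lt_top
    · rw [hpow, integral_eq_lintegral_of_nonneg_ae hnn hmeas, ← hmom,
        ENNReal.toReal_ofReal (by positivity)]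
  have hint := inner_aeval_eq A x μ hm
  -- squared norm as an lintegral
  have hsq : ∀ q : ℝ[X], ‖aeval A q x‖ ^ 2 = ∫ t, (q.eval t) ^ 2 ∂μ := by
    intro q
    have h1 := (hint (q * q)).2
    rw [map_mul, mul_apply_eq_comp] at h1
    nth_rewrite 1 [← (isSelfAdjoint_aeval_real A hAsa q).star_eq] at h1
    rw [ContinuousLinearMap.star_eq_adjoint, ContinuousLinearMap.adjoint_inner_left,
      inner_self_eq_norm_sq] at h1
    rw [h1]
    simp [pow_two]
  have hsqk : ∀ q : ℝ[X], ‖star (N ^ k) (aeval A q x)‖ ^ 2 = ∫ t, t ^ k * (q.eval t) ^ 2 ∂μ := by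
    intro q
    have h1 := (hint (q * (X ^ k * q))).2
    rw [map_mul, map_mul, map_pow, aeval_X, mul_apply_eq_comp, mul_apply_eq_comp] at h1
    nth_rewrite 1 [← (isSelfAdjoint_aeval_real A hAsa q).star_eq] at h1
    rw [ContinuousLinearMap.star_eq_adjoint, ContinuousLinearMap.adjoint_inner_left,
      hApow', mul_apply_eq_comp, ← ContinuousLinearMap.adjoint_inner_right,
      ← ContinuousLinearMap.star_eq_adjoint, inner_self_eq_norm_sq] at h1
    rw [h1]
    refine integral_congr_ae (Filter.Eventually.of_forall fun t => ?_)
    simp; ring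
  have hη : ∀ n : ℕ, 0 < 1 / ((n : ℝ) + 1) := fun n => by positivity
  choose q hq using fun n : ℕ => poly_approx μ R hR k hk (1 / ((n : ℝ) + 1)) (hη n)
  set y : ℕ → K := fun n => star (N ^ k) (aeval A (q n) x) with hy
  have hmq : ∀ n, Measurable fun t : ℝ => t ^ k * ((q n).eval t - (t ^ k)⁻¹) ^ 2 := fun n => by
    have := (q n).continuous.measurable
    fun_prop
  have hcau : CauchySeq y := by
    refine cauchySeq_of_le_tendsto_0 (fun n => 2 * (1 / ((n : ℝ) + 1))) ?_ ?_
    · intro n m M hn hm'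
      rw [dist_eq_norm]
      refine le_of_sq_le_sq ?_ (by positivity)
      have e : y n - y m = star (N ^ k) (aeval A (q n - q m) x) := by
        simp [hy]
      have hnn : 0 ≤ᵐ[μ] fun t : ℝ => t ^ k * ((q n - q m).eval t) ^ 2 := by
        filter_upwards [hR] with t ht using mul_nonneg (pow_nonneg ht.1 k) (sq_nonneg _)
      rw [e, hsqk, integral_eq_lintegral_of_nonneg_ae hnn (by
        have := (q n - q m).continuous
        exact Continuous.aestronglyMeasurable (by fun_prop))]
      refine ENNReal.toReal_le_of_le_ofReal (by positivity) ?_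
      calc ∫⁻ t, ENNReal.ofReal (t ^ k * ((q n - q m).eval t) ^ 2) ∂μ
          ≤ ∫⁻ t, (2 * ENNReal.ofReal (t ^ k * ((q n).eval t - (t ^ k)⁻¹) ^ 2)
            + 2 * ENNReal.ofReal (t ^ k * ((q m).eval t - (t ^ k)⁻¹) ^ 2)) ∂μ := by
            apply lintegral_mono_ae
            filter_upwards [hR] with t ht
            have htk : 0 ≤ t ^ k := pow_nonneg ht.1 k
            rw [show (2 : ℝ≥0∞) = ENNReal.ofReal 2 by simp, ← ENNReal.ofReal_mul (by norm_num),
              ← ENNReal.ofReal_mul (by norm_num), ← ENNReal.ofReal_add (by positivity)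
              (by positivity)]
            apply ENNReal.ofReal_le_ofReal
            rw [eval_sub]
            have : 0 ≤ t ^ k * ((q n).eval t - (t ^ k)⁻¹ + ((q m).eval t - (t ^ k)⁻¹)) ^ 2 := by
              positivity
            nlinarith
        _ = 2 * ∫⁻ t, ENNReal.ofReal (t ^ k * ((q n).eval t - (t ^ k)⁻¹) ^ 2) ∂μ
            + 2 * ∫⁻ t, ENNReal.ofReal (t ^ k * ((q m).eval t - (t ^ k)⁻¹) ^ 2) ∂μ := by
            rw [lintegral_add_left ((hmq n).ennreal_ofReal.const_mul _),
              lintegral_const_mul _ (hmq n).ennreal_ofReal,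
              lintegral_const_mul _ (hmq m).ennreal_ofReal]
        _ ≤ 2 * ENNReal.ofReal ((1 / ((M : ℝ) + 1)) ^ 2)
            + 2 * ENNReal.ofReal ((1 / ((M : ℝ) + 1)) ^ 2) := by
            gcongr
            · refine (hq n).trans (ENNReal.ofReal_le_ofReal ?_)
              gcongr
            · refine (hq m).trans (ENNReal.ofReal_le_ofReal ?_)
              gcongr
        _ = ENNReal.ofReal ((2 * (1 / ((M : ℝ) + 1))) ^ 2) := by
            rw [show (2 : ℝ≥0∞) = ENNReal.ofReal 2 by simp, ← ENNReal.ofReal_mul (by norm_num),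
              ← ENNReal.ofReal_add (by positivity) (by positivity)]
            congr 1
            ring
    · have := tendsto_one_div_add_atTop_nhds_zero_nat (𝕜 := ℝ)
      simpa using this.const_mul 2
  obtain ⟨y0, hy0⟩ := cauchySeq_tendsto_of_complete hcau
  refine ⟨y0, ?_⟩
  have hlim : Filter.Tendsto (fun n => (N ^ k) (y n)) Filter.atTop (nhds ((N ^ k) y0)) :=
    ((N ^ k).continuous.tendsto y0).comp hy0
  refine tendsto_nhds_unique hlim ?_
  have hbd : ∀ n, ‖(N ^ k) (y n) - x‖ ^ 2 ≤ R ^ k * (1 / ((n : ℝ) + 1)) ^ 2 := by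
    intro n
    have e : (N ^ k) (y n) - x = aeval A (X ^ k * q n - 1) x := by
      rw [map_sub, map_mul, map_pow, aeval_X, map_one, hApow']
      simp [hy]
    rw [e, hsq, integral_eq_lintegral_of_nonneg_ae
      (Filter.Eventually.of_forall fun t => sq_nonneg _) (by
        have := (X ^ k * q n - 1).continuous
        exact Continuous.aestronglyMeasurable (by fun_prop))]
    refine ENNReal.toReal_le_of_le_ofReal (by positivity) ?_
    calc ∫⁻ t, ENNReal.ofReal (((X ^ k * q n - 1).eval t) ^ 2) ∂μ
        ≤ ∫⁻ t, ENNReal.ofReal (R ^ k) *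
            ENNReal.ofReal (t ^ k * ((q n).eval t - (t ^ k)⁻¹) ^ 2) ∂μ := by
          apply lintegral_mono_ae
          filter_upwards [hR, hne] with t ht ht0
          rw [← ENNReal.ofReal_mul (by positivity)]
          apply ENNReal.ofReal_le_ofReal
          have htk : 0 ≤ t ^ k := pow_nonneg ht.1 k
          have htk0 : t ^ k ≠ 0 := pow_ne_zero k ht0
          have htR : t ^ k ≤ R ^ k := pow_le_pow_left₀ ht.1 ht.2 k
          have e2 : ((X ^ k * q n - 1).eval t) ^ 2
              = t ^ k * (t ^ k * ((q n).eval t - (t ^ k)⁻¹) ^ 2) := by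
            simp only [eval_sub, eval_mul, eval_pow, eval_X, eval_one]
            field_simp
          rw [e2]
          gcongr
      _ = ENNReal.ofReal (R ^ k) *
            ∫⁻ t, ENNReal.ofReal (t ^ k * ((q n).eval t - (t ^ k)⁻¹) ^ 2) ∂μ := by
          rw [lintegral_const_mul _ (hmq n).ennreal_ofReal]
      _ ≤ ENNReal.ofReal (R ^ k) * ENNReal.ofReal ((1 / ((n : ℝ) + 1)) ^ 2) := by
          gcongr
          exact hq n
      _ = _ := by rw [← ENNReal.ofReal_mul (by positivity)]
  rw [tendsto_iff_norm_sub_tendsto_zero]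
  have h1 : Filter.Tendsto (fun n : ℕ => R ^ k * (1 / ((n : ℝ) + 1)) ^ 2) Filter.atTop
      (nhds 0) := by
    have := tendsto_one_div_add_atTop_nhds_zero_nat (𝕜 := ℝ)
    simpa using (this.pow 2).const_mul (R ^ k)
  have h2 : Filter.Tendsto (fun n => ‖(N ^ k) (y n) - x‖ ^ 2) Filter.atTop (nhds 0) :=
    squeeze_zero (fun n => sq_nonneg _) hbd h1
  have h3 := h2.sqrt
  simpa using h3

lemma exists_depth {V : Type u} (p : V → V) (htree : IsDirectedTree p) (ω : V) (hω : p ω = ω) :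
    ∃ d : V → ℕ, d ω = 0 ∧ ∀ v, v ≠ ω → d v = d (p v) + 1 := by
  have hfix : ∀ m : ℕ, p^[m] ω = ω := fun m => Function.iterate_fixed hω m
  have hex : ∀ v, ∃ n, p^[n] v = ω := by
    intro v
    obtain ⟨m, n, h⟩ := htree.2 ω v
    exact ⟨n, by rw [← h, hfix]⟩
  refine ⟨fun v => Nat.find (hex v), ?_, ?_⟩
  · simp
  · intro v hv
    exact Nat.find_comp_succ (hex v) (hex (p v)) (by simpa using hv)

lemma exists_chain {K : Type u} [NormedAddCommGroup K] [InnerProductSpace ℂ K]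
    (N : K →L[ℂ] K) (x y : K) (hx : ‖x‖ = 1) (k : ℕ) (hy : (N ^ k) y = x) :
    ∃ (z : ℕ → K) (c : ℕ → ℂ), z 0 = x ∧ (∀ i ≤ k, ‖z i‖ = 1) ∧ (∀ i < k, c i ≠ 0) ∧
      ∀ i < k, N (z (i + 1)) = c i • z i := by
  have hne : ∀ m ≤ k, (N ^ m) y ≠ 0 := by
    intro m hm h
    have : (N ^ k) y = 0 := by
      rw [← Nat.sub_add_cancel hm, pow_add, mul_apply_eq_comp, h, map_zero]
    rw [hy] at this
    simp [this] at hx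
  refine ⟨fun i => ((‖(N ^ (k - i)) y‖⁻¹ : ℝ) : ℂ) • (N ^ (k - i)) y,
    fun i => ((‖(N ^ (k - i)) y‖ / ‖(N ^ (k - (i + 1))) y‖ : ℝ) : ℂ), ?_, ?_, ?_, ?_⟩
  · simp [hy, hx]
  · intro i hi
    have := hne (k - i) (by omega)
    rw [norm_smul, Complex.norm_real, norm_inv, norm_norm]
    exact inv_mul_cancel₀ (norm_ne_zero_iff.mpr this)
  · intro i hi
    have h1 := hne (k - i) (by omega)
    have h2 := hne (k - (i + 1)) (by omega)
    exact Complex.ofReal_ne_zero.mpr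
      (div_ne_zero (norm_ne_zero_iff.mpr h1) (norm_ne_zero_iff.mpr h2))
  · intro i hi
    have h1 := hne (k - i) (by omega)
    have e : N ((N ^ (k - (i + 1))) y) = (N ^ (k - i)) y := by
      rw [← mul_apply_eq_comp, ← pow_succ']
      congr 2
      omega
    simp only [map_smul, e]
    rw [smul_smul]
    congr 1
    rw [← Complex.ofReal_mul]
    congr 1
    have : ‖(N ^ (k - i)) y‖ ≠ 0 := by simpa using h1
    field_simp

lemma inner_single_single' {K : Type u} [NormedAddCommGroup K] [InnerProductSpace ℂ K]
    (n m : ℤ) (a b : K) :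
    inner ℂ (lp.single 2 n a : lp (fun _ : ℤ => K) 2) (lp.single 2 m b)
      = if n = m then inner ℂ a b else 0 := by
  rw [lp.inner_single_left, lp.single_apply, Pi.single_apply]
  split_ifs <;> simp

lemma backward {V : Type u} (p : V → V) (htree : IsDirectedTree p)
    (ω : V) (hω : p ω = ω)
    (lam : V → ℂ) (hw : WeightSystem p lam)
    (S : Hs V →L[ℂ] Hs V) (hS : IsWeightedShift p lam S)
    (hsub : Subnormal S) (k : ℕ) (hk : 1 ≤ k) (μ : MeasureTheory.Measure ℝ)
    (hμ : IsRepresentingMeasure μ (fun n => ‖(S ^ n) (ev ω)‖ ^ 2))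
    (hint : ∫⁻ x : ℝ, (ENNReal.ofReal (x ^ k))⁻¹ ∂μ < ⊤) :
    ∃ mu : Fin k → ℂ, (∀ j, mu j ≠ 0) ∧
      ∃ S' : Hs (V ⊕ Fin k) →L[ℂ] Hs (V ⊕ Fin k),
        IsWeightedShift (extParent p ω k) (extWeights lam ω k mu) S' ∧ Subnormal S' := by
  obtain ⟨K, _, _, _, J, N, hN, hJ⟩ := hsub
  have hJn : ∀ n f, (N ^ n) (J f) = J ((S ^ n) f) := by
    intro n
    induction n with
    | zero => intro f; simp
    | succ n ih =>
      intro f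
      rw [pow_succ, mul_apply_eq_comp, hJ, ih, pow_succ, mul_apply_eq_comp]
  have hevn : ∀ v : V, ‖(ev v : Hs V)‖ = 1 := by
    intro v
    simp [ev]
  obtain ⟨y, hy⟩ := mem_range_of_measure N hN (J (ev ω)) μ (by
    simp only [hJn, LinearIsometry.norm_map]
    exact hμ) k hk hint
  obtain ⟨z, c, hz0, hz1, hc0, hcz⟩ := exists_chain N (J (ev ω)) y
    (by rw [LinearIsometry.norm_map, hevn]) k hy
  obtain ⟨d, hd0, hd⟩ := exists_depth p htree ω hω
  obtain ⟨D, hD, hDs⟩ := exists_graded_normal N hN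
  have hDsingle : ∀ (n : ℤ) (a : K), D (lp.single 2 n a) = lp.single 2 (n + 1) (N a) := by
    intro n a
    ext m
    rw [hDs, lp.single_apply, lp.single_apply, Pi.single_apply, Pi.single_apply]
    by_cases h : m = n + 1
    · subst h; simp
    · have : m - 1 ≠ n := by omega
      simp [h, this]
  have hevin : ∀ v w : V, inner ℂ (ev v : Hs V) (ev w) = if v = w then (1:ℂ) else 0 := by
    intro v w
    unfold ev
    rw [lp.inner_single_left, lp.single_apply, Pi.single_apply]
    split_ifs <;> simp
  have hSev : ∀ v w : V, inner ℂ (ev w : Hs V) (S (ev v)) = if p w = v then lam w else 0 := by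
    intro v w
    have := hS (ev v) w
    unfold ev at this ⊢
    rw [lp.inner_single_left, this, lp.single_apply, Pi.single_apply]
    split_ifs <;> simp
  let b : V ⊕ Fin k → lp (fun _ : ℤ => K) 2 := Sum.elim
    (fun v => lp.single 2 (d v : ℤ) (J (ev v)))
    (fun j => lp.single 2 (-((j : ℕ) : ℤ) - 1) (z ((j : ℕ) + 1)))
  have hbl : ∀ v, b (Sum.inl v) = lp.single 2 (d v : ℤ) (J (ev v)) := fun v => rfl
  have hbr : ∀ j : Fin k, b (Sum.inr j) = lp.single 2 (-((j : ℕ) : ℤ) - 1) (z ((j : ℕ) + 1)) :=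
    fun v => rfl
  have hdz : ∀ v, d v = 0 → v = ω := by
    intro v h
    by_contra hne
    have := hd v hne
    omega
  refine ⟨fun j => c j, fun j => hc0 j j.2, ?_⟩
  refine exists_shift_of_orthonormal D hD b ?_ ?_ _ _ ?_
  · rw [orthonormal_iff_ite]
    rintro (v | i) (w | j)
    · rw [hbl, hbl, inner_single_single', J.inner_map_map, hevin]
      by_cases h : v = w
      · subst h; simp
      · simp [h]
    · rw [hbl, hbr, inner_single_single', if_neg (by omega)]
      simp
    · rw [hbl, hbr, inner_single_single', if_neg (by omega)]
      simp
    · rw [hbr, hbr, inner_single_single']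
      by_cases h : i = j
      · subst h
        simp [inner_self_eq_norm_sq_to_K, hz1 ((i : ℕ) + 1) i.2]
      · have : (i : ℕ) ≠ j := fun h' => h (Fin.ext h')
        rw [if_neg (by omega), if_neg (by simpa using h)]
  · rintro (v | j)
    · rw [hbl, hDsingle, hJ]
      have h1 : HasSum (fun i => lp.single 2 i (S (ev v) i)) (S (ev v)) :=
        lp.hasSum_single (by simp) _
      let T : K →L[ℂ] lp (fun _ : ℤ => K) 2 := lp.singleContinuousLinearMap ℂ (fun _ : ℤ => K) 2 ((d v : ℤ) + 1)
      have hT : ∀ a, T a = lp.single 2 ((d v : ℤ) + 1) a := fun a => rfl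
      have h2 := h1.mapL (T ∘L J.toContinuousLinearMap)
      have h3 : (T ∘L J.toContinuousLinearMap) (S (ev v)) = lp.single 2 ((d v : ℤ) + 1) (J (S (ev v))) := rfl
      rw [h3] at h2
      refine (Submodule.isClosed_topologicalClosure _).mem_of_tendsto h2
        (Filter.Eventually.of_forall fun s => ?_)
      refine Submodule.sum_mem _ fun i _ => ?_
      have h4 : (lp.single 2 i (S (ev v) i) : Hs V) = (S (ev v) i : ℂ) • ev i := by
        unfold ev
        rw [← lp.single_smul]
        simp
      rw [h4, map_smul]
      have h5 : (S (ev v) i : ℂ) = if p i = v then lam i else 0 := by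
        have := hS (ev v) i
        unfold ev at this ⊢
        rw [this, lp.single_apply, Pi.single_apply]
        split_ifs <;> simp
      by_cases h6 : p i = v
      · by_cases h7 : i = ω
        · have : lam i = 0 := hw i (by rw [h7, hω])
          rw [h5, this]
          simp
        · have h8 := hd i h7
          rw [h6] at h8
          have h9 : (T ∘L J.toContinuousLinearMap) (ev i) = b (Sum.inl i) := by
            rw [hbl, h8]
            push_cast
            rfl
          rw [h9]
          exact Submodule.smul_mem _ _ (Submodule.le_topologicalClosure _
            (Submodule.subset_span ⟨_, rfl⟩))
      · rw [h5, if_neg h6]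
        simp
    · rw [hbr, hDsingle, hcz j j.2, lp.single_smul]
      apply Submodule.smul_mem
      apply Submodule.le_topologicalClosure
      apply Submodule.subset_span
      by_cases hj : (j : ℕ) = 0
      · refine ⟨Sum.inl ω, ?_⟩
        rw [hbl, hd0, hj, hz0]
        simp
      · refine ⟨Sum.inr ⟨(j : ℕ) - 1, by omega⟩, ?_⟩
        rw [hbr]
        congr 1
        · simp; omega
        · congr 1; simp; omega
  · rintro (w | i) (v | j)
    · rw [hbl, hbl, hDsingle, inner_single_single', hJ, J.inner_map_map, hSev]
      by_cases hwω : w = ω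
      · simp [extParent, hwω, show 0 < k from hk, hd0]
        intro h
        omega
      · simp only [extParent, extWeights, if_neg hwω, Sum.inl.injEq]
        by_cases h : p w = v
        · have := hd w hwω
          rw [h] at this
          rw [if_pos (by omega)]
        · simp [h]
    · rw [hbl, hbr, hDsingle, inner_single_single', hcz j j.2]
      by_cases hwω : w = ω
      · subst hwω
        simp only [extParent, extWeights, if_true, dif_pos (show 0 < k from hk), hd0,
          Sum.inr.injEq]
        by_cases hj : (j : ℕ) = 0
        · have : (⟨0, hk⟩ : Fin k) = j := Fin.ext hj.symm
          rw [if_pos (by omega), if_pos this, hj, hz0, inner_smul_right, J.inner_map_map, hevin]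
          simp
        · have : (⟨0, hk⟩ : Fin k) ≠ j := fun h => hj (by rw [← h])
          rw [if_neg (by omega), if_neg this]
      · have := hd w hwω
        rw [if_neg (by omega)]
        simp [extParent, hwω]
    · rw [hbl, hbr, hDsingle, inner_single_single', if_neg (by omega)]
      have hne : extParent p ω k (Sum.inr i) ≠ Sum.inl v := by
        simp only [extParent]
        split_ifs <;> exact Sum.inr_ne_inl
      rw [if_neg hne]
    · rw [hbr, hbr, hDsingle, inner_single_single', hcz j j.2]
      simp only [extParent, extWeights]
      by_cases hi : (i : ℕ) + 1 < k
      · rw [dif_pos hi, dif_pos hi]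
        by_cases hj : (j : ℕ) = (i : ℕ) + 1
        · have : (⟨(i : ℕ) + 1, hi⟩ : Fin k) = j := Fin.ext hj.symm
          rw [if_pos (by omega), if_pos (by rw [this]), hj, inner_smul_right,
            inner_self_eq_norm_sq_to_K, hz1 _ (by omega)]
          simp
        · have : (⟨(i : ℕ) + 1, hi⟩ : Fin k) ≠ j := fun h => hj (by rw [← h])
          rw [if_neg (by omega), if_neg (by simpa using this)]
      · rw [dif_neg hi, dif_neg hi, if_neg (by omega)]
        simp

lemma forward {V : Type u} (p : V → V) 
    (ω : V) (hω : p ω = ω)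
    (lam : V → ℂ) (hw : WeightSystem p lam)
    (S : Hs V →L[ℂ] Hs V) (hS : IsWeightedShift p lam S)
    (k : ℕ) (hk : 1 ≤ k) (mu : Fin k → ℂ) (hmu : ∀ j, mu j ≠ 0)
    (S' : Hs (V ⊕ Fin k) →L[ℂ] Hs (V ⊕ Fin k))
    (hS' : IsWeightedShift (extParent p ω k) (extWeights lam ω k mu) S')
    (hsub : Subnormal S') :
    ∃ μ : MeasureTheory.Measure ℝ,
        IsRepresentingMeasure μ (fun n => ‖(S ^ n) (ev ω)‖ ^ 2) ∧
        ∫⁻ x : ℝ, (ENNReal.ofReal (x ^ k))⁻¹ ∂μ < ⊤ := by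
  obtain ⟨K, _, _, _, J, N, hN, hJ⟩ := hsub
  have hJn : ∀ n f, (N ^ n) (J f) = J ((S' ^ n) f) := by
    intro n
    induction n with
    | zero => intro f; simp
    | succ n ih =>
      intro f
      rw [pow_succ, mul_apply_eq_comp, hJ, ih, pow_succ, mul_apply_eq_comp]
  -- powers of `S'` on the old tree
  have hrel : ∀ n : ℕ, (∀ v, ((S' ^ n) (ev (Sum.inl ω)) : ∀ _ : V ⊕ Fin k, ℂ) (Sum.inl v)
        = ((S ^ n) (ev ω) : ∀ _ : V, ℂ) v) ∧
      ∀ j, ((S' ^ n) (ev (Sum.inl ω)) : ∀ _ : V ⊕ Fin k, ℂ) (Sum.inr j) = 0 := by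
    intro n
    induction n with
    | zero =>
      constructor
      · intro v
        simp [ev, lp.single_apply, Pi.single_apply]
      · intro v
        simp [ev, lp.single_apply, Pi.single_apply]
    | succ n ih =>
      constructor
      · intro v
        rw [pow_succ', pow_succ', mul_apply_eq_comp, mul_apply_eq_comp, hS', hS]
        by_cases hv : v = ω
        · subst hv
          have : extParent p v k (Sum.inl v) = Sum.inr ⟨0, hk⟩ := by
            simp [extParent, show 0 < k from hk]
          rw [this, ih.2, hw v hω]
          simp
        · simp only [extParent, extWeights, if_neg hv]
          rw [ih.1]
      · intro j
        rw [pow_succ', mul_apply_eq_comp, hS']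
        simp only [extParent]
        split_ifs <;> rw [ih.2] <;> simp
  have hnorm : ∀ n : ℕ, ‖(S' ^ n) (ev (Sum.inl ω))‖ ^ 2 = ‖(S ^ n) (ev ω)‖ ^ 2 := by
    intro n
    have h1 := lp.hasSum_norm (by simp) ((S' ^ n) (ev (Sum.inl ω)))
    have h2 := lp.hasSum_norm (by simp) ((S ^ n) (ev ω))
    simp only [ENNReal.toReal_ofNat, Real.rpow_ofNat] at h1 h2
    rw [← Function.Injective.hasSum_iff (Sum.inl_injective (β := Fin k))] at h1
    · refine h1.unique ?_
      convert! h2 using 1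
      ext v
      rw [Function.comp_apply, (hrel n).1 v]
    · rintro (v | j) hv
      · exact absurd ⟨v, rfl⟩ hv
      · rw [(hrel n).2]; simp
  -- the chain
  have hchain : ∀ i : ℕ, ∀ hi : i < k, ∃ a : ℂ, a ≠ 0 ∧
      (S' ^ (i + 1)) (ev (Sum.inr ⟨i, hi⟩)) = a • ev (Sum.inl ω) := by
    intro i
    induction i with
    | zero =>
      intro hi
      refine ⟨mu ⟨0, hi⟩, hmu _, ?_⟩
      rw [zero_add, pow_one]
      ext w
      rw [hS', lp.coeFn_smul, Pi.smul_apply]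
      simp only [ev, lp.single_apply, Pi.single_apply]
      rcases w with v | j
      · by_cases hv : v = ω
        · simp [extParent, extWeights, hv, hi]
        · simp [extParent, extWeights, hv]
      · simp only [extParent, extWeights]
        split_ifs <;> simp_all
    | succ i ih =>
      intro hi
      obtain ⟨a, ha, h⟩ := ih (by omega)
      refine ⟨mu ⟨i + 1, hi⟩ * a, mul_ne_zero (hmu _) ha, ?_⟩
      have e : S' (ev (Sum.inr ⟨i + 1, hi⟩)) = mu ⟨i + 1, hi⟩ • ev (Sum.inr ⟨i, by omega⟩) := by
        ext w
        rw [hS', lp.coeFn_smul, Pi.smul_apply]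
        simp only [ev, lp.single_apply, Pi.single_apply]
        rcases w with v | j
        · by_cases hv : v = ω
          · simp [extParent, extWeights, hv, show 0 < k by omega]
          · simp [extParent, extWeights, hv]
        · by_cases hj : (j : ℕ) + 1 < k
          · have e1 : extParent p ω k (Sum.inr j) = Sum.inr ⟨(j : ℕ) + 1, hj⟩ := by
              simp [extParent, hj]
            have e2 : extWeights lam ω k mu (Sum.inr j) = mu ⟨(j : ℕ) + 1, hj⟩ := by
              simp [extWeights, hj]
            simp only [e1, e2]
            by_cases hji : (j : ℕ) = i
            · subst hji
              simp
            · have : j ≠ ⟨i, by omega⟩ := fun h => hji (by rw [h])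
              simp [this, hji]
          · have : j ≠ ⟨i, by omega⟩ := fun h => hj (by rw [h]; exact hi)
            have e2 : extWeights lam ω k mu (Sum.inr j) = 0 := by
              simp [extWeights, hj]
            simp [e2, this]
      rw [pow_succ, mul_apply_eq_comp, e, map_smul, h, smul_smul]
  obtain ⟨a, ha, hae⟩ := hchain (k - 1) (by omega)
  rw [Nat.sub_add_cancel hk] at hae
  set x := J (ev (Sum.inr ⟨k - 1, by omega⟩)) with hx
  obtain ⟨ν, hνfin, hν0, hν⟩ := exists_measure_of_normal N hN x
  have hx2 : ∀ n : ℕ, ‖(N ^ (n + k)) x‖ ^ 2 = ‖a‖ ^ 2 * ‖(S ^ n) (ev ω)‖ ^ 2 := by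
    intro n
    rw [hx, hJn, J.norm_map, pow_add, mul_apply_eq_comp, hae, map_smul, norm_smul, mul_pow, hnorm]
  have hnn : ∀ᵐ t ∂ν, 0 ≤ t := by
    rw [MeasureTheory.ae_iff]
    simpa [Set.Iio] using hν0
  have ha2 : 0 < ‖a‖ ^ 2 := by positivity
  have hmeas : Measurable (fun t : ℝ => ENNReal.ofReal ((‖a‖ ^ 2)⁻¹ * t ^ k)) := by fun_prop
  refine ⟨ν.withDensity (fun t => ENNReal.ofReal ((‖a‖ ^ 2)⁻¹ * t ^ k)), ⟨?_, ?_⟩, ?_⟩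
  · exact MeasureTheory.withDensity_absolutelyContinuous _ _ hν0
  · intro n
    rw [MeasureTheory.lintegral_withDensity_eq_lintegral_mul _ hmeas (by fun_prop)]
    have e : ∫⁻ t, ((fun t : ℝ => ENNReal.ofReal ((‖a‖ ^ 2)⁻¹ * t ^ k)) *
        fun t : ℝ => ENNReal.ofReal (t ^ n)) t ∂ν
        = ∫⁻ t, ENNReal.ofReal (‖a‖ ^ 2)⁻¹ * ENNReal.ofReal (t ^ (n + k)) ∂ν := by
      apply MeasureTheory.lintegral_congr_ae
      filter_upwards [hnn] with t ht
      rw [Pi.mul_apply, ← ENNReal.ofReal_mul (by positivity), ← ENNReal.ofReal_mul (by positivity)]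
      congr 1
      ring
    rw [e, MeasureTheory.lintegral_const_mul _ (by fun_prop), ← hν]
    simp only
    rw [hx2,
      ← ENNReal.ofReal_mul (by positivity)]
    congr 1
    field_simp
  · rw [MeasureTheory.lintegral_withDensity_eq_lintegral_mul _ hmeas (by fun_prop)]
    refine lt_of_le_of_lt (MeasureTheory.lintegral_mono (g := fun _ => ENNReal.ofReal (‖a‖ ^ 2)⁻¹)
      fun t => ?_) ?_
    · simp only [Pi.mul_apply]
      rw [ENNReal.ofReal_mul (by positivity), mul_assoc]
      exact mul_le_of_le_one_right' (ENNReal.mul_inv_le_one _)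
    · rw [MeasureTheory.lintegral_const]
      exact ENNReal.mul_lt_top ENNReal.ofReal_lt_top hνfin

/-- Theorem (extSub-shift): a bounded subnormal weighted shift on a rooted directed
tree admits a subnormal `k`-step backward extension iff the Stieltjes moment sequence
`(‖S^n e_ω‖²)` has a representing measure `μ` with `∫ t^{-k} dμ(t) < ∞`. -/
theorem extSubShift {V : Type u} (p : V → V) (htree : IsDirectedTree p)
    (ω : V) (hω : p ω = ω)
    (lam : V → ℂ) (hw : WeightSystem p lam)
    (S : Hs V →L[ℂ] Hs V) (hS : IsWeightedShift p lam S)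
    (hsub : Subnormal S) (k : ℕ) (hk : 1 ≤ k) :
    AdmitsSubnormalBackExt p lam ω S k ↔
      ∃ μ : MeasureTheory.Measure ℝ,
        IsRepresentingMeasure μ (fun n => ‖(S ^ n) (ev ω)‖ ^ 2) ∧
        ∫⁻ x : ℝ, (ENNReal.ofReal (x ^ k))⁻¹ ∂μ < ⊤ := by
  constructor
  · rintro ⟨-, mu, hmu, S', hS', hsub'⟩
    exact forward p ω hω lam hw S hS k hk mu hmu S' hS' hsub'
  · rintro ⟨μ, hμ, hint⟩
    exact ⟨hsub, backward p htree ω hω lam hw S hS hsub k hk μ hμ hint⟩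

end ShiftsPaper
end
end

section
/- A proper bounded weighted shift S_λ on a directed forest T=(V,p) is power hyponormal if and only if both of the following hold: (a) the forest T is leafless; and (b) h_k(v) := ∑_{u ∈ Chi^⟨k⟩(v)} |λ^(k)_u|² / ‖S_λ^k e_u‖² ≤ 1 for every v ∈ V and every k ≥ 1. -/
open scoped ENNReal Classical
noncomputable section

universe u

namespace ShiftsPaper

theorem aux_adj_iff {E : Type u} [NormedAddCommGroup E] [InnerProductSpace ℂ E]
    [CompleteSpace E] (A : E →L[ℂ] E) :
    Hyponormal A ↔ ∀ g, ‖ContinuousLinearMap.adjoint A g‖ ^ 2 ≤ ‖A g‖ ^ 2 := by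
  have key : ∀ g, (ContinuousLinearMap.adjoint A ∘L A
      - A ∘L ContinuousLinearMap.adjoint A).reApplyInnerSelf g
      = ‖A g‖ ^ 2 - ‖ContinuousLinearMap.adjoint A g‖ ^ 2 := by
    intro g
    rw [ContinuousLinearMap.reApplyInnerSelf_apply]
    simp only [ContinuousLinearMap.sub_apply, ContinuousLinearMap.comp_apply, inner_sub_left,
      map_sub]
    rw [ContinuousLinearMap.adjoint_inner_left, inner_self_eq_norm_sq,
      ← ContinuousLinearMap.adjoint_inner_right, inner_self_eq_norm_sq]
  have hsa : IsSelfAdjoint (ContinuousLinearMap.adjoint A ∘L A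
      - A ∘L ContinuousLinearMap.adjoint A) :=
    (IsSelfAdjoint.star_mul_self A).sub (IsSelfAdjoint.mul_star_self A)
  unfold Hyponormal
  rw [ContinuousLinearMap.isPositive_def']
  constructor
  · intro h g
    have := h.2 g
    rw [key] at this
    linarith
  · intro h
    refine ⟨hsa, fun g => ?_⟩
    rw [key]
    linarith [h g]

theorem aux_norm {V : Type u} (f : Hs V) :
    ENNReal.ofReal (‖f‖ ^ 2) = ∑' v, ‖f v‖ₑ ^ 2 := by
  have h := lp.hasSum_norm (p := 2) (by norm_num) f
  simp only [ENNReal.toReal_ofNat, Real.rpow_ofNat] at h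
  rw [← h.tsum_eq, ENNReal.ofReal_tsum_of_nonneg (fun _ => by positivity) h.summable]
  congr 1
  ext v
  rw [ENNReal.ofReal_pow (norm_nonneg _), ofReal_norm]

theorem aux_ev {V : Type u} (u x : V) : (ev u : Hs V) x = if x = u then 1 else 0 := by
  unfold ev
  split_ifs with h
  · subst h; simp
  · simp [lp.single_apply_ne, h]

section
variable {V : Type u} {q : V → V} {m : V → ℂ} {A : Hs V →L[ℂ] Hs V}

/-- fibre-summation -/
theorem aux_fib (q : V → V) (a b : V → ℝ≥0∞) :
    ∑' v, a v * b (q v) = ∑' u, (∑' v, if q v = u then a v else 0) * b u := by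
  simp_rw [← ENNReal.tsum_mul_right]
  rw [ENNReal.tsum_comm]
  congr 1
  ext v
  rw [tsum_eq_single (q v)]
  · simp
  · intro u hu
    simp [Ne.symm hu]

theorem aux_W (hA : ∀ (f : Hs V) v, A f v = m v * f (q v)) (u : V) :
    ENNReal.ofReal (‖A (ev u)‖ ^ 2) = ∑' v, if q v = u then ‖m v‖ₑ ^ 2 else 0 := by
  rw [aux_norm]
  congr 1
  ext v
  rw [hA, aux_ev]
  split_ifs <;> simp

theorem aux_normA (hA : ∀ (f : Hs V) v, A f v = m v * f (q v)) (f : Hs V) :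
    ENNReal.ofReal (‖A f‖ ^ 2) = ∑' u, ENNReal.ofReal (‖A (ev u)‖ ^ 2) * ‖f u‖ₑ ^ 2 := by
  simp_rw [aux_W hA]
  rw [aux_norm, ← aux_fib q (fun v => ‖m v‖ₑ ^ 2) (fun v => ‖f v‖ₑ ^ 2)]
  congr 1
  ext v
  rw [hA, enorm_mul, mul_pow]

theorem aux_amgm (W : ℝ) (hW : 0 ≤ W) (g m f : ℂ) (h : W = 0 → m = 0) :
    2 * (‖g‖ₑ * (‖m‖ₑ * ‖f‖ₑ)) ≤ ENNReal.ofReal W * ‖g‖ₑ ^ 2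
      + ‖m‖ₑ ^ 2 / ENNReal.ofReal W * ‖f‖ₑ ^ 2 := by
  rcases hW.eq_or_lt with h0 | h0
  · simp [h h0.symm]
  · simp_rw [← ofReal_norm]
    rw [← ENNReal.ofReal_pow (norm_nonneg _), ← ENNReal.ofReal_pow (norm_nonneg _),
      ← ENNReal.ofReal_pow (norm_nonneg _), ← ENNReal.ofReal_div_of_pos h0,
      ← ENNReal.ofReal_mul (by positivity), ← ENNReal.ofReal_mul (by positivity),
      ← ENNReal.ofReal_mul (by positivity), ← ENNReal.ofReal_mul (by positivity),
      ← ENNReal.ofReal_add (by positivity) (by positivity),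
      show (2 : ℝ≥0∞) = ENNReal.ofReal 2 by simp, ← ENNReal.ofReal_mul (by positivity)]
    apply ENNReal.ofReal_le_ofReal
    have : W * ‖g‖ ^ 2 + ‖m‖ ^ 2 / W * ‖f‖ ^ 2 - 2 * (‖g‖ * (‖m‖ * ‖f‖))
        = (W * ‖g‖ - ‖m‖ * ‖f‖) ^ 2 / W := by
      field_simp
      ring
    have h2 : 0 ≤ (W * ‖g‖ - ‖m‖ * ‖f‖) ^ 2 / W := by positivity
    linarith

theorem aux_inner (f g : Hs V) : ‖inner ℂ f g‖ₑ ≤ ∑' v, ‖f v‖ₑ * ‖g v‖ₑ := by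
  rw [lp.inner_eq_tsum]
  refine (enorm_tsum_le_tsum_enorm).trans ?_
  refine ENNReal.tsum_le_tsum fun v => ?_
  rw [← enorm_norm (f v), ← enorm_norm (g v), ← enorm_mul]
  simp only [← ofReal_norm]
  apply ENNReal.ofReal_le_ofReal
  simpa using norm_inner_le_norm (𝕜 := ℂ) (f v) (g v)

theorem aux_suff (hA : ∀ (f : Hs V) v, A f v = m v * f (q v))
    (h : ∀ u, (∑' v, if q v = u then ‖m v‖ₑ ^ 2 / ENNReal.ofReal (‖A (ev v)‖ ^ 2) else 0) ≤ 1) :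
    Hyponormal A := by
  rw [aux_adj_iff]
  intro g
  set f := ContinuousLinearMap.adjoint A g with hf
  have hm : ∀ v, ‖A (ev v)‖ ^ 2 = 0 → m v = 0 := by
    intro v hv
    by_contra hne
    have h1 := (ENNReal.le_tsum v).trans (h (q v))
    rw [if_pos rfl, hv, ENNReal.ofReal_zero, ENNReal.div_zero (by simpa using hne)] at h1
    simp at h1
  have h1 : 2 * ENNReal.ofReal (‖f‖ ^ 2) ≤ ENNReal.ofReal (‖A g‖ ^ 2) + ENNReal.ofReal (‖f‖ ^ 2) := by
    have e1 : ENNReal.ofReal (‖f‖ ^ 2) = ‖inner ℂ g (A f)‖ₑ := by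
      rw [← ContinuousLinearMap.adjoint_inner_left, ← hf, inner_self_eq_norm_sq_to_K,
        ← ofReal_norm]
      simp
    calc 2 * ENNReal.ofReal (‖f‖ ^ 2) ≤ 2 * ∑' v, ‖g v‖ₑ * ‖A f v‖ₑ := by
          rw [e1]; gcongr; exact aux_inner _ _
      _ = ∑' v, 2 * (‖g v‖ₑ * (‖m v‖ₑ * ‖f (q v)‖ₑ)) := by
          rw [ENNReal.tsum_mul_left]
          simp_rw [hA, enorm_mul]
      _ ≤ ∑' v, (ENNReal.ofReal (‖A (ev v)‖ ^ 2) * ‖g v‖ₑ ^ 2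
            + ‖m v‖ₑ ^ 2 / ENNReal.ofReal (‖A (ev v)‖ ^ 2) * ‖f (q v)‖ₑ ^ 2) :=
          ENNReal.tsum_le_tsum fun v => aux_amgm _ (by positivity) _ _ _ (hm v)
      _ ≤ _ := by
          rw [ENNReal.tsum_add, ← aux_normA hA g,
            aux_fib q (fun v => ‖m v‖ₑ ^ 2 / ENNReal.ofReal (‖A (ev v)‖ ^ 2))
              (fun v => ‖f v‖ₑ ^ 2), aux_norm f]
          gcongr with u
          calc _ ≤ 1 * ‖f u‖ₑ ^ 2 := by gcongr; exact h u
            _ = _ := one_mul _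
  rw [← ENNReal.ofReal_add (by positivity) (by positivity),
      two_mul, ← ENNReal.ofReal_add (by positivity) (by positivity),
      ENNReal.ofReal_le_ofReal_iff (by positivity)] at h1
  linarith

theorem aux_test (hA : ∀ (f : Hs V) v, A f v = m v * f (q v)) (hyp : Hyponormal A)
    (g : Hs V) (u : V) : ‖inner ℂ g (A (ev u))‖ ^ 2 ≤ ‖A g‖ ^ 2 := by
  rw [aux_adj_iff] at hyp
  refine le_trans ?_ (hyp g)
  rw [← ContinuousLinearMap.adjoint_inner_left]
  gcongr
  refine (norm_inner_le_norm _ _).trans ?_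
  simp [ev, lp.norm_single]

theorem aux_zero (hA : ∀ (f : Hs V) v, A f v = m v * f (q v)) (hyp : Hyponormal A)
    (v : V) (hv : A (ev v) = 0) : m v = 0 := by
  have h := aux_test hA hyp (ev v) (q v)
  rw [hv, ev, lp.inner_single_left, hA, aux_ev] at h
  simpa using h

theorem aux_nec (hA : ∀ (f : Hs V) v, A f v = m v * f (q v)) (hyp : Hyponormal A) (u : V) :
    (∑' v, if q v = u then ‖m v‖ₑ ^ 2 / ENNReal.ofReal (‖A (ev v)‖ ^ 2) else 0) ≤ 1 := by
  rw [ENNReal.tsum_eq_iSup_sum]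
  refine iSup_le fun F => ?_
  rw [← Finset.sum_filter]
  set F' := F.filter (fun v => q v = u) with hF'
  have hq : ∀ v ∈ F', q v = u := fun v hv => (Finset.mem_filter.1 hv).2
  set w : V → ℝ := fun v => ‖A (ev v)‖ ^ 2 with hw
  have hw0 : ∀ v, 0 ≤ w v := fun v => by positivity
  have hz : ∀ v, w v = 0 → m v = 0 := fun v hv => aux_zero hA hyp v (by simpa [hw] using hv)
  have hterm : ∀ v ∈ F', ‖m v‖ₑ ^ 2 / ENNReal.ofReal (w v) = ENNReal.ofReal (‖m v‖ ^ 2 / w v) := by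
    intro v _
    rcases (hw0 v).eq_or_lt with h0 | h0
    · simp [hz v h0.symm]
    · rw [ENNReal.ofReal_div_of_pos h0, ENNReal.ofReal_pow (norm_nonneg (m v)), ofReal_norm]
  rw [Finset.sum_congr rfl hterm, ← ENNReal.ofReal_sum_of_nonneg (fun v _ => by positivity),
    ENNReal.ofReal_le_one]
  set H := ∑ v ∈ F', ‖m v‖ ^ 2 / w v with hH
  have hH0 : 0 ≤ H := Finset.sum_nonneg fun v _ => by positivity
  set g : Hs V := ∑ v ∈ F', lp.single 2 v (m v / (w v : ℂ)) with hg
  have hgv : ∀ x, g x = if x ∈ F' then m x / (w x : ℂ) else 0 := by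
    intro x
    rw [hg, lp.coeFn_sum, Finset.sum_apply]
    simp only [lp.coeFn_single, Finset.sum_pi_single]
  have hin : inner ℂ g (A (ev u)) = (H : ℂ) := by
    rw [hg, sum_inner, hH, Complex.ofReal_sum]
    refine Finset.sum_congr rfl fun v hv => ?_
    rw [lp.inner_single_left, hA, aux_ev, if_pos (hq v hv)]
    simp only [RCLike.inner_apply, map_div₀, Complex.conj_ofReal, mul_one]
    push_cast
    rw [mul_div_assoc', Complex.mul_conj, Complex.normSq_eq_norm_sq]
    push_cast
    rfl
  have hAg : ‖A g‖ ^ 2 = H := by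
    rw [← ENNReal.ofReal_eq_ofReal_iff (by positivity) hH0, aux_normA hA,
      tsum_eq_sum (s := F') (by intro v hv; simp [hgv, hv]), hH,
      ENNReal.ofReal_sum_of_nonneg (fun v _ => by positivity)]
    refine Finset.sum_congr rfl fun v hv => ?_
    rw [hgv, if_pos hv, ← ofReal_norm, ← ENNReal.ofReal_pow (norm_nonneg _),
      ← ENNReal.ofReal_mul (by positivity)]
    congr 1
    change w v * _ = _
    rw [norm_div, Complex.norm_real, Real.norm_of_nonneg (hw0 v)]
    rcases (hw0 v).eq_or_lt with h0 | h0
    · simp [← h0]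
    · field_simp
  have ht := aux_test hA hyp g u
  rw [hin, hAg, Complex.norm_real, Real.norm_of_nonneg hH0] at ht
  nlinarith

end

theorem aux_pow {V : Type u} {p : V → V} {lam : V → ℂ} {S : Hs V →L[ℂ] Hs V}
    (hS : IsWeightedShift p lam S) (k : ℕ) :
    ∀ (f : Hs V) v, (S ^ k) f v = iterWeight p lam k v * f (p^[k] v) := by
  induction k with
  | zero => intro f v; simp [iterWeight]
  | succ k ih =>
    intro f v
    rw [pow_succ', ContinuousLinearMap.mul_apply, hS, ih, iterWeight, Function.iterate_succ_apply]
    ring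

theorem aux_root {V : Type u} {p : V → V} {lam : V → ℂ} (hproper : ProperWeights p lam) (j : ℕ) :
    ∀ v, p (p^[j] v) = p^[j] v → iterWeight p lam (j + 1) v = 0 := by
  induction j with
  | zero => intro v hv; simp [iterWeight, (hproper v).2 hv]
  | succ j ih =>
    intro v hv
    rw [iterWeight, ih (p v) hv, zero_mul]

theorem aux_tsum {V : Type u} {p : V → V} {lam : V → ℂ} (hproper : ProperWeights p lam)
    (S : Hs V →L[ℂ] Hs V) (k : ℕ) (hk : 1 ≤ k) (v : V) :
    (∑' u : ↥(childrenIter p k v), ENNReal.ofReal (‖iterWeight p lam k ↑u‖ ^ 2) /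
              ENNReal.ofReal (‖(S ^ k) (ev (↑u : V))‖ ^ 2))
    = ∑' u, if p^[k] u = v then ‖iterWeight p lam k u‖ₑ ^ 2 /
        ENNReal.ofReal (‖(S ^ k) (ev u)‖ ^ 2) else 0 := by
  obtain ⟨j, rfl⟩ : ∃ j, k = j + 1 := ⟨k - 1, by omega⟩
  rw [tsum_subtype (childrenIter p (j + 1) v)
    (fun u => ENNReal.ofReal (‖iterWeight p lam (j + 1) u‖ ^ 2) /
              ENNReal.ofReal (‖(S ^ (j + 1)) (ev u)‖ ^ 2))]
  congr 1
  ext u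
  by_cases hu : u ∈ childrenIter p (j + 1) v
  · rw [Set.indicator_of_mem hu, if_pos hu.1, ENNReal.ofReal_pow (norm_nonneg _), ofReal_norm]
  · rw [Set.indicator_of_notMem hu]
    split_ifs with h
    · have h2 : p^[j] u = v := by
        by_contra h3
        exact hu ⟨h, h3⟩
      rw [aux_root hproper j u (by rw [← Function.iterate_succ_apply' p, h, h2])]
      simp
    · rfl

/-- Corollary (power-hypo): a proper bounded weighted shift on a directed forest is
power hyponormal iff the forest is leafless and `h_k(v) ≤ 1` for all `v ∈ V`, `k ≥ 1`. -/
theorem powerHypoChar {V : Type u} (p : V → V) (hforest : IsDirectedForest p)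
    (lam : V → ℂ) (hproper : ProperWeights p lam)
    (S : Hs V →L[ℂ] Hs V) (hS : IsWeightedShift p lam S) :
    PowerHyponormal S ↔
      (Leafless p ∧
        ∀ (v : V) (k : ℕ), 1 ≤ k →
          (∑' u : ↥(childrenIter p k v),
            ENNReal.ofReal (‖iterWeight p lam k ↑u‖ ^ 2) /
              ENNReal.ofReal (‖(S ^ k) (ev (↑u : V))‖ ^ 2)) ≤ 1) := by
  constructor
  · intro hyp
    refine ⟨?_, ?_⟩
    · intro v
      by_contra hv
      push Not at hv
      have h0 : (S ^ 1) (ev v) = 0 := by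
        ext x
        rw [aux_pow hS, aux_ev]
        simp [hv x]
      have h1 := aux_zero (aux_pow hS 1) (hyp 1 le_rfl) v h0
      simp only [iterWeight, one_mul] at h1
      exact hv v ((hproper v).1 h1)
    · intro v k hk
      rw [aux_tsum hproper S k hk v]
      exact aux_nec (aux_pow hS k) (hyp k hk) v
  · rintro ⟨_, h⟩ k hk
    refine aux_suff (aux_pow hS k) fun u => ?_
    rw [← aux_tsum hproper S k hk u]
    exact h u k hk

end ShiftsPaper
end
end
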